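/- arXiv:2409.07027 — 6 statements merged into one kernel-verified Lean document; each statement's English description precedes it below -/
import Mathlib

section
/- There exists N ∈ ℕ such that for all integers n ≥ N the following holds for the numbers a_j = 1/((n−j)! · (log(j+e))^j), 0 ≤ j ≤ n: (a) if j is an integer with n/2 < j and j ≤ n − log n − 2, then a_j ≤ a_{j+1}; (b) if j is an integer with n − log n + 1 ≤ j ≤ n − 1, then a_j ≥ a_{j+1}. -/
open Real

/-- The sequence `a_j = 1/((n-j)! (log(j+e))^j)` from Lemma 2.1 of the paper. -/
noncomputable def aSeq (n j : ℕ) : ℝ :=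
  1 / ((Nat.factorial (n - j) : ℝ) * Real.log ((j : ℝ) + Real.exp 1) ^ j)

theorem one_lt_log_natCast_add_exp_one {j : ℕ} (hj : 0 < j) : 1 < log ((j : ℝ) + exp 1) := by
  rw [lt_log_iff_exp_lt (by positivity)]
  have : (0 : ℝ) < j := by exact_mod_cast hj
  linarith

theorem aSeq_pos {n j : ℕ} (hj : 0 < j) : 0 < aSeq n j := by
  have := one_lt_log_natCast_add_exp_one hj
  unfold aSeq
  positivity

theorem aSeq_succ_mul {n j : ℕ} (hj : 0 < j) (hjn : j < n) :
    aSeq n (j + 1) * log ((j + 1 : ℕ) + exp 1) ^ (j + 1) =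
      aSeq n j * (((n : ℝ) - j) * log (j + exp 1) ^ j) := by
  have h₀ := one_lt_log_natCast_add_exp_one hj
  have h₁ := one_lt_log_natCast_add_exp_one j.succ_pos
  obtain ⟨m, rfl⟩ := Nat.exists_eq_add_of_lt hjn
  have e₁ : j + m + 1 - j = m + 1 := by omega
  have e₂ : j + m + 1 - (j + 1) = m := by omega
  have e₃ : ((j + m + 1 : ℕ) : ℝ) - j = (m + 1 : ℕ) := by push_cast; ring
  rw [aSeq, aSeq, e₁, e₂, e₃, Nat.factorial_succ, Nat.cast_mul]
  field_simp

theorem aSeq_le_succ_iff {n j : ℕ} (hj : 0 < j) (hjn : j < n) :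
    aSeq n j ≤ aSeq n (j + 1) ↔
      log ((j + 1 : ℕ) + exp 1) ^ (j + 1) ≤ ((n : ℝ) - j) * log (j + exp 1) ^ j := by
  have h := one_lt_log_natCast_add_exp_one j.succ_pos
  rw [← mul_le_mul_iff_left₀ (by positivity : 0 < log ((j + 1 : ℕ) + exp 1) ^ (j + 1)),
    aSeq_succ_mul hj hjn, mul_le_mul_iff_right₀ (aSeq_pos hj)]

theorem aSeq_succ_le_iff {n j : ℕ} (hj : 0 < j) (hjn : j < n) :
    aSeq n (j + 1) ≤ aSeq n j ↔
      ((n : ℝ) - j) * log (j + exp 1) ^ j ≤ log ((j + 1 : ℕ) + exp 1) ^ (j + 1) := by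
  have h := one_lt_log_natCast_add_exp_one j.succ_pos
  rw [← mul_le_mul_iff_left₀ (by positivity : 0 < log ((j + 1 : ℕ) + exp 1) ^ (j + 1)),
    aSeq_succ_mul hj hjn, mul_le_mul_iff_right₀ (aSeq_pos hj)]

theorem log_add_one_le_log_add_inv {x : ℝ} (hx : 0 < x) : log (x + 1) ≤ log x + 1 / x := by
  have h := log_le_sub_one_of_pos (x := (x + 1) / x) (by positivity)
  rw [log_div (by positivity) hx.ne'] at h
  have : (x + 1) / x - 1 = 1 / x := by field_simp; ring
  linarith

theorem log_succ_pow_succ_le {j : ℕ} (hj : 10 ≤ j) :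
    log ((j + 1 : ℕ) + exp 1) ^ (j + 1) ≤
      (log (j + exp 1) + 2) * log (j + exp 1) ^ j := by
  have hj' : (10 : ℝ) ≤ j := by exact_mod_cast hj
  have he := exp_one_gt_d9
  have he' := exp_one_lt_d9
  set y : ℝ := j + exp 1 with hy
  have hy0 : 12 < y := by linarith
  have hL : 2 ≤ log y := by
    rw [le_log_iff_exp_le (by positivity), show (2 : ℝ) = 1 + 1 by norm_num, exp_add]
    nlinarith
  have hsucc : ((j + 1 : ℕ) : ℝ) + exp 1 = y + 1 := by push_cast; ring
  rw [hsucc]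
  set L := log y
  have hstep : log (y + 1) ≤ L + 1 / y := log_add_one_le_log_add_inv (by positivity)
  have hpos : 0 ≤ log (y + 1) := log_nonneg (by linarith)
  have hmul : log (y + 1) ≤ L * exp (1 / (y * L)) := by
    have h := mul_le_mul_of_nonneg_left (add_one_le_exp (1 / (y * L))) (by positivity : 0 ≤ L)
    have : L * (1 / (y * L) + 1) = L + 1 / y := by field_simp; ring
    linarith
  have hpow : log (y + 1) ^ j ≤ L ^ j * exp (1 / L) := by
    calc log (y + 1) ^ j ≤ (L * exp (1 / (y * L))) ^ j := by gcongr
      _ = L ^ j * exp (j * (1 / (y * L))) := by rw [mul_pow, ← exp_nat_mul]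
      _ ≤ L ^ j * exp (1 / L) := by
        gcongr
        rw [mul_one_div, div_le_div_iff₀ (by positivity) (by positivity)]
        nlinarith
  have hinv : 1 / L ≤ 1 / 2 := by gcongr
  have hinv0 : 0 < 1 / L := by positivity
  have hexp : exp (1 / L) ≤ 1 + 1 / L + (1 / L) ^ 2 := by
    have h := abs_exp_sub_one_sub_id_le (x := 1 / L) (by rw [abs_of_pos hinv0]; linarith)
    linarith [(abs_le.mp h).2]
  have hy1 : 1 / y ≤ 1 / 12 := by gcongr
  have hcoef : (L + 1 / y) * exp (1 / L) ≤ L + 2 := by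
    calc (L + 1 / y) * exp (1 / L) ≤ (L + 1 / 12) * (1 + 1 / L + (1 / L) ^ 2) := by gcongr
      _ = L + 1 + 1 / L + 1 / 12 * (1 + 1 / L + (1 / L) ^ 2) := by field_simp
      _ ≤ L + 2 := by nlinarith
  calc log (y + 1) ^ (j + 1) = log (y + 1) * log (y + 1) ^ j := pow_succ' _ _
    _ ≤ (L + 1 / y) * (L ^ j * exp (1 / L)) := by gcongr
    _ = (L + 1 / y) * exp (1 / L) * L ^ j := by ring
    _ ≤ (L + 2) * L ^ j := by gcongr

theorem aSeq_le_succ {n j : ℕ} (hn : 20 ≤ n) (hj : (n : ℝ) / 2 < j)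
    (hjn : (j : ℝ) ≤ n - log n - 2) : aSeq n j ≤ aSeq n (j + 1) := by
  have hn' : (20 : ℝ) ≤ n := by exact_mod_cast hn
  have he := exp_one_lt_d9
  have hlog : 1 ≤ log n := by rw [le_log_iff_exp_le (by positivity)]; linarith
  have hj10 : 10 ≤ j := by
    have : (10 : ℝ) ≤ j := by linarith
    exact_mod_cast this
  have hlt : j < n := by
    have : (j : ℝ) < n := by linarith
    exact_mod_cast this
  have hmono : log (j + exp 1) ≤ log n := log_le_log (by positivity) (by linarith)
  have hL := one_lt_log_natCast_add_exp_one (j := j) (by omega)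
  rw [aSeq_le_succ_iff (by omega) hlt]
  refine (log_succ_pow_succ_le hj10).trans ?_
  gcongr
  linarith

theorem aSeq_succ_le {n j : ℕ} (hn : 2 ≤ n) (hj : (n : ℝ) - log n + 1 ≤ j)
    (hjn : j ≤ n - 1) : aSeq n (j + 1) ≤ aSeq n j := by
  have hn' : (2 : ℝ) ≤ n := by exact_mod_cast hn
  have he := exp_one_gt_d9
  have hhalf : log n ≤ n / 2 := by
    have h := log_le_sub_one_of_pos (x := (n : ℝ) / 2) (by positivity)
    rw [log_div (by positivity) two_ne_zero] at h
    linarith [log_two_lt_d9]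
  have hj0 : 0 < j := by
    have : (0 : ℝ) < j := by linarith
    exact_mod_cast this
  have hlog : log n ≤ log ((j + 1 : ℕ) + exp 1) + 1 := by
    rw [← log_exp 1, ← log_mul (by positivity) (exp_ne_zero 1), log_exp]
    refine log_le_log (by positivity) ?_
    push_cast
    nlinarith
  have hL := one_lt_log_natCast_add_exp_one hj0
  have hL' := one_lt_log_natCast_add_exp_one j.succ_pos
  rw [aSeq_succ_le_iff hj0 (by omega), pow_succ']
  gcongr
  · linarith
  · omega

/-- **Monotonicity of `a_j`** (Lemma 2.1 of the paper): for `n` sufficiently large,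
`a_j ≤ a_{j+1}` when `n/2 < j ≤ n - log n - 2`, and `a_j ≥ a_{j+1}` when
`j ≥ n - log n + 1` (and `j ≤ n - 1`). -/
theorem aSeq_monotonicity :
    ∃ N : ℕ, ∀ n : ℕ, N ≤ n →
      (∀ j : ℕ, (n : ℝ) / 2 < (j : ℝ) → (j : ℝ) ≤ (n : ℝ) - Real.log n - 2 →
        aSeq n j ≤ aSeq n (j + 1)) ∧
      (∀ j : ℕ, (n : ℝ) - Real.log n + 1 ≤ (j : ℝ) → j ≤ n - 1 →
        aSeq n (j + 1) ≤ aSeq n j) := by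
  exact ⟨20, fun n hn => ⟨fun _ => aSeq_le_succ hn, fun _ => aSeq_succ_le (by omega)⟩⟩
end

section
/- For every real constant L > 1 there exist constants C > 0 and N ∈ ℕ such that for all integers n ≥ N and every integer j with n − L·log n − 1 < j ≤ n − L·log n, one has a_j ≤ C / (n^{L·log(L/e)} · (log n)^{n + 1/2}), where a_j = 1/((n−j)! · (log(j+e))^j). -/
open Real

lemma mul_log_sub_le_mul_log_sub {x y : ℝ} (hx : 0 < x) (hy : 0 < y) :
    x * log y - y ≤ x * log x - x := by
  have h := log_le_sub_one_of_pos (div_pos hy hx)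
  rw [log_div hy.ne' hx.ne'] at h
  have h' := mul_le_mul_of_nonneg_left h hx.le
  have h1 : x * (y / x - 1) = y - x := by field_simp
  linarith

lemma mul_log_log_sub_log_log_le {t s c : ℝ} (ht : 0 ≤ t) (hts : t ≤ s) (hp : 0 < t + c)
    (hc : 0 ≤ c) (hs : 1 < s) (hw : 0 < log (t + c)) :
    t * (log (log s) - log (log (t + c))) ≤ (s - t) / log (t + c) := by
  have hls := log_pos hs
  have h1 := log_le_sub_one_of_pos (div_pos hls hw)
  rw [log_div hls.ne' hw.ne'] at h1
  have h2 := log_le_sub_one_of_pos (div_pos (by linarith : 0 < s) hp)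
  rw [log_div (by linarith) hp.ne'] at h2
  have h3 : t * (log s - log (t + c)) ≤ s - t := by
    refine (mul_le_mul_of_nonneg_left h2 ht).trans ?_
    rw [div_sub_one hp.ne', ← mul_div_assoc, div_le_iff₀ hp]
    nlinarith [mul_nonneg (sub_nonneg.2 hts) hc]
  calc t * (log (log s) - log (log (t + c)))
      ≤ t * (log s / log (t + c) - 1) := mul_le_mul_of_nonneg_left h1 ht
    _ = t * (log s - log (t + c)) / log (t + c) := by field_simp
    _ ≤ _ := by gcongr

/-- **Upper bound for `a_j` at `j = n - L log n`** (Lemma 2.3 of the paper):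
if `j = n - L log n` with `L > 1`, then for `n` sufficiently large
`a_j ≤ C / (n^{L log(L/e)} (log n)^{n+1/2})`. -/
theorem aSeq_bound_L :
    ∀ L : ℝ, 1 < L → ∃ C : ℝ, 0 < C ∧ ∃ N : ℕ, ∀ n : ℕ, N ≤ n →
      ∀ j : ℕ, (n : ℝ) - L * Real.log n - 1 < (j : ℝ) →
        (j : ℝ) ≤ (n : ℝ) - L * Real.log n →
        aSeq n j ≤ C /
          ((n : ℝ) ^ (L * Real.log (L / Real.exp 1)) *
            Real.log n ^ ((n : ℝ) + 1 / 2)) := by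
  intro L hL
  have hL0 : 0 < L := by linarith
  have hlim : ∀ᶠ n : ℕ in Filter.atTop, L * log n ≤ (n : ℝ) / 4 := by
    have h := (isLittleO_log_id_atTop.comp_tendsto
      (tendsto_natCast_atTop_atTop (R := ℝ))).bound (by positivity : 0 < 1 / (4 * L))
    filter_upwards [h] with n hn
    simp only [Function.comp_apply, id, norm_eq_abs, Nat.abs_cast] at hn
    have h' := mul_le_mul_of_nonneg_left ((le_abs_self _).trans hn) hL0.le
    have : L * (1 / (4 * L) * (n : ℝ)) = n / 4 := by field_simp
    linarith
  obtain ⟨N, hN⟩ := Filter.eventually_atTop.1 hlim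
  refine ⟨exp (2 * L + 1), exp_pos _, max N 4, fun n hn j hj1 hj2 => ?_⟩
  have hn4 : (4 : ℝ) ≤ n := by exact_mod_cast (le_max_right N 4).trans hn
  have hsmall := hN n ((le_max_left N 4).trans hn)
  have hx : 0 < log n := log_pos (by linarith)
  have hy : 0 < L * log n := by positivity
  have hjn : j ≤ n := by
    have : (j : ℝ) ≤ n := by linarith
    exact_mod_cast this
  set m := n - j with hm
  have hmR : (m : ℝ) = n - j := by rw [hm, Nat.cast_sub hjn]
  have hm0 : (0 : ℝ) < m := by linarith
  have he : 1 ≤ exp 1 := one_le_exp zero_le_one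
  set w := log ((j : ℝ) + exp 1) with hw
  have hw1 : 1 ≤ w := by
    rw [hw, le_log_iff_exp_le (by positivity)]
    linarith [Nat.cast_nonneg (α := ℝ) j]
  have hw2 : log n ≤ 2 * w := by
    have h : (n : ℝ) ≤ ((j : ℝ) + exp 1) ^ 2 := by nlinarith
    simpa [log_pow] using log_le_log (by linarith) h
  have hlogs : j * (log (log n) - log w) ≤ 2 * L + 1 := by
    refine (mul_log_log_sub_log_log_le (Nat.cast_nonneg j) (by linarith : (j : ℝ) ≤ n)
      (by linarith [Nat.cast_nonneg (α := ℝ) j]) (exp_pos 1).le (by linarith)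
      (by linarith)).trans ?_
    rw [div_le_iff₀ (by linarith)]
    nlinarith
  have hfac := Stirling.le_log_factorial_stirling (n := m) (by exact_mod_cast hm0.ne')
  have hpi : 0 ≤ log (2 * π) := log_nonneg (by linarith [pi_gt_three])
  have htan := mul_log_sub_le_mul_log_sub hm0 hy
  rw [log_mul hL0.ne' hx.ne'] at htan
  have hlogL := log_pos hL
  have hmL : L * log n * log L ≤ m * log L :=
    mul_le_mul_of_nonneg_right (by linarith) hlogL.le
  have hlogm : log (log n) ≤ log m := log_le_log hx (by nlinarith)
  rw [aSeq, ← hm, ← hw, div_le_div_iff₀ (by positivity) (by positivity), one_mul,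
    rpow_def_of_pos (by linarith : (0 : ℝ) < n), rpow_def_of_pos hx, ← exp_add,
    ← exp_log (by positivity : 0 < (m.factorial : ℝ) * w ^ j), ← exp_add, exp_le_exp,
    log_mul (by positivity) (by positivity), log_pow, log_div hL0.ne' (exp_pos 1).ne', log_exp]
  have hsplit : log (log n) * n = m * log (log n) + j * log (log n) := by rw [hmR]; ring
  linarith
end

section
/- For every d ≥ 1 there exists a constant K > 0 such that for all real numbers κ > 1, C₀ > 0 and C ≥ κ C₀, and every multi-index α ∈ ℕ₀ᵈ, one has ∑_{β+γ=α} (α!/(β! γ!)) · C₀^{|β|} C^{|γ|} |γ|! / (log(|γ|+e))^{|γ|} ≤ K (1/log κ + 1) · (|α|+1)! · C^{|α|} / (log(|α|+1+e))^{|α|+1}, where the sum ranges over all pairs of multi-indices β, γ ∈ ℕ₀ᵈ with β + γ = α. -/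
open Real

/-- The multi-index factorial `α! = α₁!⋯α_d!`. -/
def mfactorial {d : ℕ} (α : Fin d → ℕ) : ℕ := ∏ i, Nat.factorial (α i)

/-- The length `|α| = α₁+⋯+α_d` of a multi-index. -/
def mlen {d : ℕ} (α : Fin d → ℕ) : ℕ := ∑ i, α i

/-- A multi-index sum of products of binomial coefficients weighted by a function of the length
reduces to a one-dimensional binomial sum. -/
theorem sum_prod_choose_mul {d : ℕ} (α : Fin d → ℕ) (F : ℕ → ℝ) :
    ∑ β ∈ Finset.Iic α, (∏ i, ((α i).choose (β i) : ℝ)) * F (mlen β) =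
      ∑ k ∈ Finset.range (mlen α + 1), ((mlen α).choose k : ℝ) * F k := by
  have hIic : Finset.Iic α = Fintype.piFinset fun i => Finset.range (α i + 1) := by
    ext β
    simp [Pi.le_def]
  have hpoly : ∑ β ∈ Finset.Iic α,
      Polynomial.monomial (mlen β) (∏ i, ((α i).choose (β i) : ℝ)) =
        (1 + Polynomial.X : Polynomial ℝ) ^ mlen α := by
    rw [mlen, ← Finset.prod_pow_eq_pow_sum, hIic]
    have hi : ∀ i, (1 + Polynomial.X : Polynomial ℝ) ^ α i =
        ∑ b ∈ Finset.range (α i + 1), Polynomial.X ^ b * Polynomial.C ((α i).choose b : ℝ) := by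
      intro i
      rw [add_comm, add_pow]
      simp
    simp_rw [hi]
    rw [Finset.prod_univ_sum]
    refine Finset.sum_congr rfl fun β _ => ?_
    rw [Finset.prod_mul_distrib, Finset.prod_pow_eq_pow_sum, ← map_prod, mul_comm,
      Polynomial.C_mul_X_pow_eq_monomial, mlen]
  have hcoeff : ∀ k, ∑ β ∈ Finset.Iic α with mlen β = k, ∏ i, ((α i).choose (β i) : ℝ) =
      ((mlen α).choose k : ℝ) := by
    intro k
    have h := congrArg (fun p => Polynomial.coeff p k) hpoly
    simpa [Polynomial.coeff_monomial, Polynomial.finsetSum_coeff, Finset.sum_filter,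
      Polynomial.coeff_one_add_X_pow] using h
  have hmaps : ∀ β ∈ Finset.Iic α, mlen β ∈ Finset.range (mlen α + 1) := by
    intro β hβ
    rw [Finset.mem_range, Nat.lt_succ_iff]
    exact Finset.sum_le_sum fun i _ => (Finset.mem_Iic.mp hβ) i
  rw [← Finset.sum_fiberwise_of_maps_to hmaps]
  refine Finset.sum_congr rfl fun k _ => ?_
  rw [← hcoeff k, Finset.sum_mul]
  refine Finset.sum_congr rfl fun β hβ => ?_
  rw [(Finset.mem_filter.mp hβ).2]

theorem mfactorial_div_eq_prod_choose {d : ℕ} {α β : Fin d → ℕ} (h : β ≤ α) :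
    (mfactorial α : ℝ) / ((mfactorial β : ℝ) * (mfactorial (α - β) : ℝ)) =
      ∏ i, ((α i).choose (β i) : ℝ) := by
  simp only [mfactorial, Nat.cast_prod, ← Finset.prod_mul_distrib, ← Finset.prod_div_distrib]
  exact Finset.prod_congr rfl fun i _ => (Nat.cast_choose ℝ (h i)).symm

theorem mlen_sub {d : ℕ} {α β : Fin d → ℕ} (h : β ≤ α) : mlen (α - β) = mlen α - mlen β := by
  simp only [mlen, Pi.sub_apply]
  exact Finset.sum_tsub_distrib _ fun i _ => h i

theorem one_le_log_add_exp_one {x : ℝ} (hx : 0 ≤ x) : 1 ≤ log (x + exp 1) := by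
  rw [le_log_iff_exp_le (by positivity)]
  linarith

theorem mul_log_div_log_le {x y : ℝ} (hx : 0 ≤ x) (hxy : x ≤ y) :
    x * log (log (y + exp 1) / log (x + exp 1)) ≤ 5 / log (y + exp 1) * (y - x) := by
  have ha := one_le_log_add_exp_one hx
  have hb := one_le_log_add_exp_one (hx.trans hxy)
  have he := exp_pos 1
  have hxe : 0 < x + exp 1 := by linarith
  set a := log (x + exp 1)
  set b := log (y + exp 1)
  have hz1 : 1 ≤ (y + exp 1) / (x + exp 1) := by
    rw [one_le_div hxe]
    linarith
  have ht : b - a = log ((y + exp 1) / (x + exp 1)) :=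
    (log_div (by linarith) hxe.ne').symm
  have hzx : ((y + exp 1) / (x + exp 1) - 1) * x ≤ y - x := by
    rw [show (y + exp 1) / (x + exp 1) - 1 = (y - x) / (x + exp 1) by field_simp; ring,
      div_mul_eq_mul_div, div_le_iff₀ hxe]
    nlinarith
  set z := (y + exp 1) / (x + exp 1)
  have hz0 : 0 < z := by linarith
  have ht0 : 0 ≤ b - a := by
    rw [ht]
    exact log_nonneg hz1
  have ht1 : b - a ≤ z - 1 := by
    rw [ht]
    exact log_le_sub_one_of_pos hz0
  have ht2 : (b - a) ^ 2 ≤ 4 * (z - 1) := by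
    have hs1 : 1 ≤ √z := one_le_sqrt.mpr hz1
    have hsq : √z * √z = z := mul_self_sqrt hz0.le
    have hs : b - a ≤ 2 * (√z - 1) := by
      have h := log_le_sub_one_of_pos (show 0 < √z by linarith)
      rw [log_sqrt hz0.le] at h
      linarith
    nlinarith
  have hlog : b * log (b / a) ≤ (b - a) + (b - a) ^ 2 := by
    have h := log_le_sub_one_of_pos (show 0 < b / a by positivity)
    have hba : b / a - 1 = (b - a) / a := by field_simp
    have hd : (b - a) / a * a = b - a := by field_simp
    have hd1 : (b - a) / a ≤ b - a := div_le_self ht0 ha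
    calc b * log (b / a) ≤ b * ((b - a) / a) := by
          rw [hba] at h
          gcongr
      _ = (b - a) + (b - a) * ((b - a) / a) := by linear_combination hd
      _ ≤ _ := by nlinarith
  rw [div_mul_eq_mul_div, le_div_iff₀ (by linarith)]
  nlinarith [mul_le_mul_of_nonneg_left (hlog.trans (add_le_add ht1 ht2)) hx]

theorem log_pow_le_log_pow_mul_exp {m n : ℕ} (h : m ≤ n) :
    log ((n : ℝ) + exp 1) ^ m ≤
      log ((m : ℝ) + exp 1) ^ m * exp (5 / log ((n : ℝ) + exp 1)) ^ (n - m) := by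
  have ha := one_le_log_add_exp_one (Nat.cast_nonneg (α := ℝ) m)
  have hb := one_le_log_add_exp_one (Nat.cast_nonneg (α := ℝ) n)
  have key := mul_log_div_log_le (Nat.cast_nonneg (α := ℝ) m) (Nat.cast_le.mpr h)
  set a := log ((m : ℝ) + exp 1)
  set b := log ((n : ℝ) + exp 1)
  have hba : 0 < b / a := by positivity
  rw [← div_le_iff₀' (by positivity), ← div_pow, ← exp_log (pow_pos hba m), log_pow, ← exp_nat_mul,
    exp_le_exp, Nat.cast_sub h]
  linarith

theorem exp_mul_mul_exp_div_le {r L : ℝ} (hr0 : 0 ≤ r) (hr1 : r ≤ 1) (hL : 1 ≤ L) :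
    exp (r * L * exp (5 / L)) ≤ exp (5 * exp 5) * exp (r * L) := by
  rw [← exp_add, exp_le_exp]
  have hL0 : 0 < L := by linarith
  have hu : 5 / L ≤ 5 := div_le_self (by norm_num) hL
  have h1 : exp (5 / L) - 1 ≤ 5 / L * exp (5 / L) := by
    have h := add_one_le_exp (-(5 / L))
    have h' : exp (-(5 / L)) * exp (5 / L) = 1 := by rw [← exp_add]; simp
    nlinarith [exp_pos (5 / L)]
  have h2 : L * (exp (5 / L) - 1) ≤ 5 * exp 5 := by
    calc L * (exp (5 / L) - 1) ≤ L * (5 / L * exp (5 / L)) := by gcongr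
      _ = 5 * exp (5 / L) := by field_simp
      _ ≤ _ := by gcongr
  have h3 : 0 ≤ 5 * exp 5 := by positivity
  nlinarith [mul_le_mul_of_nonneg_left h2 hr0, mul_le_mul_of_nonneg_right hr1 h3]

theorem sum_pow_div_factorial_mul_log_pow_le {r : ℝ} (hr0 : 0 ≤ r) (hr1 : r ≤ 1) (n : ℕ) :
    ∑ k ∈ Finset.range (n + 1),
        r ^ k / (Nat.factorial k : ℝ) / log (((n - k : ℕ) : ℝ) + exp 1) ^ (n - k) ≤
      exp (5 * exp 5) * exp (r * log ((n : ℝ) + exp 1)) / log ((n : ℝ) + exp 1) ^ n := by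
  have hL := one_le_log_add_exp_one (Nat.cast_nonneg (α := ℝ) n)
  set L := log ((n : ℝ) + exp 1) with hLdef
  have hL0 : 0 < L := by linarith
  calc _ ≤ ∑ k ∈ Finset.range (n + 1),
        (r * L * exp (5 / L)) ^ k / (Nat.factorial k : ℝ) / L ^ n := by
        refine Finset.sum_le_sum fun k hk => ?_
        have hkn : k ≤ n := Nat.lt_succ_iff.mp (Finset.mem_range.mp hk)
        have ha := one_le_log_add_exp_one (Nat.cast_nonneg (α := ℝ) (n - k))
        have h := log_pow_le_log_pow_mul_exp (Nat.sub_le n k)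
        rw [Nat.sub_sub_self hkn, ← hLdef] at h
        rw [div_le_div_iff₀ (by positivity) (by positivity)]
        calc r ^ k / (Nat.factorial k : ℝ) * L ^ n
            = r ^ k / (Nat.factorial k : ℝ) * L ^ k * L ^ (n - k) := by
              rw [mul_assoc, ← pow_add, Nat.add_sub_cancel' hkn]
          _ ≤ r ^ k / (Nat.factorial k : ℝ) * L ^ k *
                (log (((n - k : ℕ) : ℝ) + exp 1) ^ (n - k) * exp (5 / L) ^ k) := by gcongr
          _ = _ := by rw [mul_pow, mul_pow]; ring
    _ ≤ exp (r * L * exp (5 / L)) / L ^ n := by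
        rw [← Finset.sum_div]
        gcongr
        exact sum_le_exp_of_nonneg (by positivity) _
    _ ≤ _ := by
        gcongr
        exact exp_mul_mul_exp_div_le hr0 hr1 hL

theorem exp_mul_log_div_log_pow_le {κ r : ℝ} (hκ : 1 < κ) (hr : r ≤ 1 / κ) (n : ℕ) :
    exp (r * log ((n : ℝ) + exp 1)) / log ((n : ℝ) + exp 1) ^ n ≤
      6 * exp 5 * (1 / log κ + 1) * (n + 1) / log ((n : ℝ) + 1 + exp 1) ^ (n + 1) := by
  have hL := one_le_log_add_exp_one (Nat.cast_nonneg (α := ℝ) n)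
  have hL' := one_le_log_add_exp_one (Nat.cast_nonneg (α := ℝ) (n + 1))
  have hpow := log_pow_le_log_pow_mul_exp (Nat.le_succ n)
  have he := exp_pos 1
  have hn : (0 : ℝ) ≤ n := Nat.cast_nonneg n
  have hne : 0 < (n : ℝ) + exp 1 := by linarith
  have hexp : exp (log ((n : ℝ) + exp 1)) = n + exp 1 := exp_log hne
  have hLL : log (((n + 1 : ℕ) : ℝ) + exp 1) ≤ 2 * log ((n : ℝ) + exp 1) := by
    have hsq : log (((n + 1 : ℕ) : ℝ) + exp 1) ≤ log (((n : ℝ) + exp 1) ^ 2) := by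
      apply log_le_log (by positivity)
      push_cast
      nlinarith [add_one_le_exp (1 : ℝ)]
    simpa [log_pow] using hsq
  rw [show (n : ℝ) + 1 + exp 1 = ((n + 1 : ℕ) : ℝ) + exp 1 by push_cast; ring]
  simp only [Nat.succ_eq_add_one, Nat.add_sub_cancel_left, pow_one] at hpow
  set L := log ((n : ℝ) + exp 1)
  set L' := log (((n + 1 : ℕ) : ℝ) + exp 1)
  have hκ0 : 0 < κ := by linarith
  have hlog : 0 < log κ := log_pos hκ
  have hpow' : L' ^ n ≤ L ^ n * exp 5 := by
    refine hpow.trans ?_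
    gcongr
    exact div_le_self (by norm_num) hL'
  have hcoef : 1 ≤ (1 / log κ + 1) * (1 - r) := by
    have h1 : 1 ≤ (1 / log κ + 1) * (1 - 1 / κ) := by
      have h := log_le_sub_one_of_pos hκ0
      rw [show (1 / log κ + 1) * (1 - 1 / κ) = (1 + log κ) * (κ - 1) / (log κ * κ) by
        field_simp, one_le_div (by positivity)]
      nlinarith
    have h2 : 0 < 1 / log κ + 1 := by positivity
    exact h1.trans (by gcongr)
  have hmain : exp (r * L) * L ≤ (1 / log κ + 1) * (n + exp 1) := by
    have h := add_one_le_exp ((1 - r) * L)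
    have hsplit : exp (r * L) * exp ((1 - r) * L) = n + exp 1 := by
      rw [← exp_add, ← hexp]
      ring_nf
    have hc : 0 < 1 / log κ + 1 := by positivity
    calc exp (r * L) * L ≤ exp (r * L) * (((1 / log κ + 1) * (1 - r)) * L) := by
          gcongr
          nlinarith
      _ = (1 / log κ + 1) * (exp (r * L) * ((1 - r) * L)) := by ring
      _ ≤ (1 / log κ + 1) * (exp (r * L) * exp ((1 - r) * L)) := by
          gcongr
          linarith
      _ = _ := by rw [hsplit]
  rw [div_le_div_iff₀ (by positivity) (by positivity)]
  calc exp (r * L) * L' ^ (n + 1) = exp (r * L) * (L' ^ n * L') := by rw [pow_succ]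
    _ ≤ exp (r * L) * (L ^ n * exp 5 * (2 * L)) := by gcongr
    _ = exp (r * L) * L * (2 * exp 5 * L ^ n) := by ring
    _ ≤ (1 / log κ + 1) * (n + exp 1) * (2 * exp 5 * L ^ n) := by gcongr
    _ ≤ (1 / log κ + 1) * (3 * (n + 1)) * (2 * exp 5 * L ^ n) := by
        gcongr
        linarith [exp_one_lt_d9]
    _ = _ := by ring

/-- **The key convolution bound in higher dimensions** (Lemma 3.1 of the paper):
for every `d ≥ 1` there is a constant `K > 0` such that for all `κ > 1`, `C₀ > 0`,
`C ≥ κ C₀` and every multi-index `α`,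
`∑_{β+γ=α} (α!/(β!γ!)) C₀^{|β|} C^{|γ|} |γ|!/(log(|γ|+e))^{|γ|}
   ≤ K (1/log κ + 1) (|α|+1)! C^{|α|} / (log(|α|+1+e))^{|α|+1}`,
where the sum is over all pairs of multi-indices `β, γ` with `β + γ = α`
(equivalently, over `β ≤ α` with `γ = α - β`). -/
theorem key_convolution_bound_high_dim (d : ℕ) (hd : 1 ≤ d) :
    ∃ K : ℝ, 0 < K ∧
      ∀ (κ C₀ C : ℝ), 1 < κ → 0 < C₀ → κ * C₀ ≤ C → ∀ α : Fin d → ℕ,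
        ∑ β ∈ Finset.Iic α,
            ((mfactorial α : ℝ) / ((mfactorial β : ℝ) * (mfactorial (α - β) : ℝ)) *
              C₀ ^ mlen β * C ^ mlen (α - β) * (Nat.factorial (mlen (α - β)) : ℝ) /
                Real.log ((mlen (α - β) : ℝ) + Real.exp 1) ^ mlen (α - β)) ≤
          K * (1 / Real.log κ + 1) * (Nat.factorial (mlen α + 1) : ℝ) * C ^ mlen α /
            Real.log ((mlen α : ℝ) + 1 + Real.exp 1) ^ (mlen α + 1) := by
  refine ⟨exp (5 * exp 5) * (6 * exp 5), by positivity, ?_⟩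
  intro κ C₀ C hκ hC₀ hC α
  have hκ0 : 0 < κ := by linarith
  have hC0 : 0 < C := lt_of_lt_of_le (by positivity) hC
  have hr : C₀ / C ≤ 1 / κ := by
    rw [div_le_div_iff₀ hC0 hκ0]
    linarith
  have hr1 : C₀ / C ≤ 1 := hr.trans ((div_le_one hκ0).mpr hκ.le)
  set n := mlen α with hn
  let F : ℕ → ℝ := fun k => C₀ ^ k * C ^ (n - k) * (Nat.factorial (n - k) : ℝ) /
    log (((n - k : ℕ) : ℝ) + exp 1) ^ (n - k)
  calc _ = ∑ β ∈ Finset.Iic α, (∏ i, ((α i).choose (β i) : ℝ)) * F (mlen β) := by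
        refine Finset.sum_congr rfl fun β hβ => ?_
        have hle : β ≤ α := Finset.mem_Iic.mp hβ
        rw [mfactorial_div_eq_prod_choose hle, mlen_sub hle]
        simp only [F, ← hn]
        ring
    _ = ∑ k ∈ Finset.range (n + 1), (n.choose k : ℝ) * F k := sum_prod_choose_mul α F
    _ = (Nat.factorial n : ℝ) * C ^ n * ∑ k ∈ Finset.range (n + 1),
          (C₀ / C) ^ k / (Nat.factorial k : ℝ) /
            log (((n - k : ℕ) : ℝ) + exp 1) ^ (n - k) := by
        rw [Finset.mul_sum]
        refine Finset.sum_congr rfl fun k hk => ?_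
        have hkn : k ≤ n := Nat.lt_succ_iff.mp (Finset.mem_range.mp hk)
        have hCn : C ^ n = C ^ k * C ^ (n - k) := by rw [← pow_add, Nat.add_sub_cancel' hkn]
        have ha := one_le_log_add_exp_one (Nat.cast_nonneg (α := ℝ) (n - k))
        simp only [F]
        rw [Nat.cast_choose ℝ hkn, hCn, div_pow]
        have hk0 : (Nat.factorial k : ℝ) ≠ 0 := by positivity
        have hnk0 : (Nat.factorial (n - k) : ℝ) ≠ 0 := by positivity
        field_simp
    _ ≤ (Nat.factorial n : ℝ) * C ^ n * (exp (5 * exp 5) *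
          (6 * exp 5 * (1 / log κ + 1) * (n + 1) / log ((n : ℝ) + 1 + exp 1) ^ (n + 1))) := by
        gcongr
        refine (sum_pow_div_factorial_mul_log_pow_le (by positivity) hr1 n).trans ?_
        rw [mul_div_assoc]
        exact mul_le_mul_of_nonneg_left (exp_mul_log_div_log_pow_le hκ hr n) (exp_pos _).le
    _ = _ := by
        rw [Nat.factorial_succ]
        push_cast
        ring
end

section
/- For C₀ > 0 let A = 1/(1+C₀²), φ(x) = A e^{i C₀ x}, and u(x) = e^{−A} e^{φ(x)} for x ∈ ℝ. Then: (a) sup_{x∈ℝ} |u(x)| = 1; (b) u'' = W u' + V u on ℝ with W = φ' and V = φ''; (c) sup_{x∈ℝ} |∂ₓⁿ W(x)| ≤ C₀ⁿ and sup_{x∈ℝ} |∂ₓⁿ V(x)| ≤ C₀ⁿ for all n ∈ ℕ₀; and (d) there exists a constant K > 0, independent of C₀, such that for every κ > 1 and every n ∈ ℕ₀, ‖∂ₓⁿ u‖_{L^∞(ℝ)} ≤ (κ C₀ + K(1/log κ + 1))ⁿ · n!/(log(n+e))ⁿ. -/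
open Real

/-- `φ(x) = A e^{i C₀ x}` with `A = 1/(1+C₀²)`. -/
noncomputable def phiEx (C₀ : ℝ) : ℝ → ℂ := fun x =>
  ((1 / (1 + C₀ ^ 2) : ℝ) : ℂ) * Complex.exp (Complex.I * (C₀ : ℂ) * (x : ℂ))

/-- `u(x) = e^{-A} e^{φ(x)}` with `A = 1/(1+C₀²)`. -/
noncomputable def uEx (C₀ : ℝ) : ℝ → ℂ := fun x =>
  ((Real.exp (-(1 / (1 + C₀ ^ 2))) : ℝ) : ℂ) * Complex.exp (phiEx C₀ x)

/-- The iterated derivatives of the restriction to `ℝ` of an entire function are the restrictions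
of its complex iterated derivatives. -/
theorem iteratedDeriv_comp_ofReal {f : ℂ → ℂ} (hf : Differentiable ℂ f) (n : ℕ) :
    iteratedDeriv n (fun x : ℝ => f x) = fun x : ℝ => iteratedDeriv n f x := by
  induction n with
  | zero => simp
  | succ n ih =>
    funext x
    rw [iteratedDeriv_succ, ih, iteratedDeriv_succ]
    have h : Differentiable ℂ (iteratedDeriv n f) :=
      hf.contDiff.differentiable_iteratedDeriv n (WithTop.coe_lt_top _)
    exact (h x).hasDerivAt.comp_ofReal.deriv

theorem hasDerivAt_phiEx (C₀ x : ℝ) :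
    HasDerivAt (phiEx C₀) (Complex.I * C₀ * phiEx C₀ x) x := by
  have h : HasDerivAt (fun z : ℂ => Complex.I * C₀ * z) (Complex.I * C₀) (x : ℂ) := by
    simpa using (hasDerivAt_id (x : ℂ)).const_mul (Complex.I * C₀)
  have h2 := (h.cexp.const_mul ((1 / (1 + C₀ ^ 2) : ℝ) : ℂ)).comp_ofReal
  exact h2.congr_deriv (by rw [phiEx]; ring)

theorem iteratedDeriv_phiEx (C₀ : ℝ) (n : ℕ) :
    iteratedDeriv n (phiEx C₀) = fun x => (Complex.I * C₀) ^ n * phiEx C₀ x := by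
  induction n with
  | zero => simp
  | succ n ih =>
    funext x
    rw [iteratedDeriv_succ, ih, ((hasDerivAt_phiEx C₀ x).const_mul _).deriv]
    ring

theorem norm_phiEx (C₀ x : ℝ) : ‖phiEx C₀ x‖ = 1 / (1 + C₀ ^ 2) := by
  have h : Complex.I * C₀ * x = ((C₀ * x : ℝ) : ℂ) * Complex.I := by push_cast; ring
  rw [phiEx, norm_mul, h, Complex.norm_exp_ofReal_mul_I, mul_one, Complex.norm_real,
    Real.norm_of_nonneg (by positivity)]

theorem norm_iteratedDeriv_phiEx {C₀ : ℝ} (hC : 0 ≤ C₀) (n : ℕ) (x : ℝ) :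
    ‖iteratedDeriv n (phiEx C₀) x‖ = C₀ ^ n * (1 / (1 + C₀ ^ 2)) := by
  simp [iteratedDeriv_phiEx, norm_phiEx, abs_of_nonneg hC]

theorem hasDerivAt_uEx (C₀ x : ℝ) :
    HasDerivAt (uEx C₀) (deriv (phiEx C₀) x * uEx C₀ x) x := by
  have h := ((hasDerivAt_phiEx C₀ x).cexp).const_mul
    ((Real.exp (-(1 / (1 + C₀ ^ 2))) : ℝ) : ℂ)
  rw [(hasDerivAt_phiEx C₀ x).deriv]
  exact h.congr_deriv (by rw [uEx]; ring)

theorem norm_uEx_le_one (C₀ x : ℝ) : ‖uEx C₀ x‖ ≤ 1 := by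
  rw [uEx, norm_mul, Complex.norm_real, Real.norm_of_nonneg (Real.exp_pos _).le,
    Complex.norm_exp, ← Real.exp_add, Real.exp_le_one_iff]
  linarith [(Complex.re_le_norm (phiEx C₀ x)).trans_eq (norm_phiEx C₀ x)]

theorem iSup_norm_uEx (C₀ : ℝ) : (⨆ x : ℝ, ‖uEx C₀ x‖) = 1 := by
  have h0 : uEx C₀ 0 = 1 := by
    simp only [uEx, phiEx, Complex.ofReal_zero, mul_zero, Complex.exp_zero, mul_one]
    rw [← Complex.ofReal_exp, ← Complex.ofReal_mul, ← Real.exp_add]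
    simp
  refine le_antisymm (ciSup_le (norm_uEx_le_one C₀)) ?_
  have h := le_ciSup (f := fun x => ‖uEx C₀ x‖) ⟨1, Set.forall_mem_range.2 (norm_uEx_le_one C₀)⟩ 0
  simpa [h0] using h

/-- The Cauchy estimate for the entire extension of `uEx C₀` on a disc of radius `r / C₀`. -/
theorem norm_iteratedDeriv_uEx_le {C₀ r : ℝ} (hC : 0 < C₀) (hr : 0 < r) (n : ℕ) (x : ℝ) :
    ‖iteratedDeriv n (uEx C₀) x‖ ≤
      n.factorial * Real.exp (1 / (1 + C₀ ^ 2) * (Real.exp r - 1)) / (r / C₀) ^ n := by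
  set A : ℝ := 1 / (1 + C₀ ^ 2) with hA
  have hA0 : 0 ≤ A := by positivity
  let f : ℂ → ℂ := fun z => ((Real.exp (-A) : ℝ) : ℂ) *
    Complex.exp ((A : ℂ) * Complex.exp (Complex.I * (C₀ : ℂ) * z))
  have hf : Differentiable ℂ f := by fun_prop
  have hu : uEx C₀ = fun x : ℝ => f x := rfl
  rw [hu, iteratedDeriv_comp_ofReal hf]
  refine Complex.norm_iteratedDeriv_le_of_forall_mem_sphere_norm_le n (div_pos hr hC)
    hf.diffContOnCl fun z hz => ?_
  have him : -z.im ≤ r / C₀ := by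
    have h := Complex.abs_im_le_norm (z - x)
    rw [mem_sphere_iff_norm.1 hz] at h
    simpa using (neg_le_abs _).trans h
  have hre : (Complex.I * (C₀ : ℂ) * z).re ≤ r := by
    rw [le_div_iff₀ hC] at him
    simp
    linarith
  have hin : ((A : ℂ) * Complex.exp (Complex.I * (C₀ : ℂ) * z)).re ≤ A * Real.exp r := by
    refine (Complex.re_le_norm _).trans ?_
    rw [norm_mul, Complex.norm_real, Real.norm_of_nonneg hA0, Complex.norm_exp]
    gcongr
  rw [norm_mul, Complex.norm_real, Real.norm_of_nonneg (Real.exp_pos _).le,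
    Complex.norm_exp, ← Real.exp_add, Real.exp_le_exp]
  linarith

/-- The Cauchy estimate with the radius for which the exponential factor becomes `e ^ (n δ)`. -/
theorem norm_iteratedDeriv_uEx_le_pow {C₀ δ : ℝ} (hC : 0 < C₀) (hδ : 0 < δ) {n : ℕ}
    (hn : 1 ≤ n) (x : ℝ) :
    ‖iteratedDeriv n (uEx C₀) x‖ ≤
      (C₀ * Real.exp δ / Real.log (1 + n * δ * (1 + C₀ ^ 2))) ^ n * n.factorial := by
  have hn0 : (0 : ℝ) < n := by exact_mod_cast hn
  have hpos : 0 < n * δ * (1 + C₀ ^ 2) := by positivity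
  have hr : 0 < Real.log (1 + n * δ * (1 + C₀ ^ 2)) := Real.log_pos (by linarith)
  refine (norm_iteratedDeriv_uEx_le hC hr n x).trans_eq ?_
  have h : 1 / (1 + C₀ ^ 2) * (1 + n * δ * (1 + C₀ ^ 2) - 1) = n * δ := by
    field_simp
    ring
  rw [Real.exp_log (by linarith), h, Real.exp_nat_mul, div_pow, div_pow, mul_pow]
  field_simp

/-- The logarithmic factorial bound for `uEx` with the explicit constant `K = 2 e²`. -/
theorem norm_iteratedDeriv_uEx_le_log {C₀ κ : ℝ} (hC : 0 < C₀) (hκ : 1 < κ) (n : ℕ) (x : ℝ) :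
    ‖iteratedDeriv n (uEx C₀) x‖ ≤
      (κ * C₀ + 2 * Real.exp 1 ^ 2 * (1 / Real.log κ + 1)) ^ n * n.factorial /
        Real.log (n + Real.exp 1) ^ n := by
  have he := Real.exp_one_gt_two
  have he3 := Real.exp_one_lt_three
  have hlκ : 0 < Real.log κ := Real.log_pos hκ
  rcases Nat.eq_zero_or_pos n with rfl | hn
  · simpa using norm_uEx_le_one C₀ x
  have hn1 : (1 : ℝ) ≤ n := by exact_mod_cast hn
  have hL : 0 < Real.log (n + Real.exp 1) := Real.log_pos (by linarith)
  suffices h : ∃ δ, 0 < δ ∧ C₀ * Real.exp δ / Real.log (1 + n * δ * (1 + C₀ ^ 2)) ≤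
      (κ * C₀ + 2 * Real.exp 1 ^ 2 * (1 / Real.log κ + 1)) / Real.log (n + Real.exp 1) by
    obtain ⟨δ, hδ, h⟩ := h
    refine (norm_iteratedDeriv_uEx_le_pow hC hδ hn x).trans ?_
    rw [mul_div_right_comm (_ ^ n), ← div_pow]
    have : 0 ≤ Real.log (1 + n * δ * (1 + C₀ ^ 2)) :=
      Real.log_nonneg (le_add_of_nonneg_right (by positivity))
    gcongr
  by_cases hbig : Real.exp 1 ≤ Real.log κ * (1 + C₀ ^ 2)
  · refine ⟨Real.log κ, hlκ, ?_⟩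
    rw [Real.exp_log (by linarith)]
    have hle : Real.log (n + Real.exp 1) ≤ Real.log (1 + n * Real.log κ * (1 + C₀ ^ 2)) := by
      apply Real.log_le_log (by linarith)
      nlinarith
    apply div_le_div₀ _ _ hL hle
    · positivity
    · have : 0 ≤ 2 * Real.exp 1 ^ 2 * (1 / Real.log κ + 1) := by positivity
      linarith
  · refine ⟨1, one_pos, ?_⟩
    have hle : Real.log (n + Real.exp 1) ≤ 2 * Real.log (1 + n * 1 * (1 + C₀ ^ 2)) := by
      rw [← Real.log_rpow (by positivity)]
      apply Real.log_le_log (by linarith)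
      norm_num
      have : (1 + (n : ℝ)) ^ 2 ≤ (1 + n * (1 + C₀ ^ 2)) ^ 2 := by
        gcongr
        nlinarith [sq_nonneg C₀]
      nlinarith
    have hCb : C₀ ≤ Real.exp 1 * (1 / Real.log κ) := by
      rw [mul_one_div, le_div_iff₀ hlκ]
      nlinarith [sq_nonneg (C₀ - 1)]
    have hM : 0 < Real.log (1 + n * 1 * (1 + C₀ ^ 2)) := by linarith
    rw [div_le_div_iff₀ hM hL]
    calc C₀ * Real.exp 1 * Real.log (n + Real.exp 1)
        ≤ C₀ * Real.exp 1 * (2 * Real.log (1 + n * 1 * (1 + C₀ ^ 2))) := by gcongr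
      _ = 2 * Real.exp 1 * C₀ * Real.log (1 + n * 1 * (1 + C₀ ^ 2)) := by ring
      _ ≤ _ := by
        gcongr
        have h1 : 2 * Real.exp 1 * C₀ ≤ 2 * Real.exp 1 * (Real.exp 1 * (1 / Real.log κ)) := by
          gcongr
        have h2 : 0 < κ * C₀ := by positivity
        nlinarith [sq_nonneg (Real.exp 1)]

/-- **The sharp example** (first part of Proposition 2.6): the function
`u = e^{-A} e^{φ}`, `φ = A e^{iC₀x}`, `A = 1/(1+C₀²)`, has sup-norm `1`, solves
`u'' = W u' + V u` with `W = φ'`, `V = φ''`, whose derivatives are bounded by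
`C₀ⁿ`, and `u` satisfies the log-type ultra-analytic bound with a constant `K`
independent of `C₀`. -/
theorem sharp_example_properties :
    (∀ C₀ : ℝ, 0 < C₀ →
      (⨆ x : ℝ, ‖uEx C₀ x‖) = 1 ∧
      (∀ x : ℝ, deriv (deriv (uEx C₀)) x =
        deriv (phiEx C₀) x * deriv (uEx C₀) x +
          deriv (deriv (phiEx C₀)) x * uEx C₀ x) ∧
      (∀ (n : ℕ) (x : ℝ),
        ‖iteratedDeriv n (deriv (phiEx C₀)) x‖ ≤ C₀ ^ n ∧
        ‖iteratedDeriv n (deriv (deriv (phiEx C₀))) x‖ ≤ C₀ ^ n)) ∧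
    ∃ K : ℝ, 0 < K ∧ ∀ C₀ : ℝ, 0 < C₀ → ∀ κ : ℝ, 1 < κ → ∀ (n : ℕ) (x : ℝ),
      ‖iteratedDeriv n (uEx C₀) x‖ ≤
        (κ * C₀ + K * (1 / Real.log κ + 1)) ^ n * (Nat.factorial n) /
          Real.log ((n : ℝ) + Real.exp 1) ^ n := by
  refine ⟨fun C₀ hC => ⟨iSup_norm_uEx C₀, fun x => ?_, fun n x => ⟨?_, ?_⟩⟩,
    2 * Real.exp 1 ^ 2, by positivity, fun C₀ hC κ hκ n x =>
      norm_iteratedDeriv_uEx_le_log hC hκ n x⟩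
  · have hd : deriv (uEx C₀) = fun x => deriv (phiEx C₀) x * uEx C₀ x :=
      funext fun x => (hasDerivAt_uEx C₀ x).deriv
    have hφ : DifferentiableAt ℝ (deriv (phiEx C₀)) x := by
      rw [funext fun x => (hasDerivAt_phiEx C₀ x).deriv]
      exact (hasDerivAt_phiEx C₀ x).differentiableAt.const_mul _
    conv_lhs => rw [hd]
    refine (hφ.hasDerivAt.mul (hasDerivAt_uEx C₀ x)).deriv.trans ?_
    rw [(hasDerivAt_uEx C₀ x).deriv]
    ring
  · rw [← iteratedDeriv_succ', norm_iteratedDeriv_phiEx hC.le, pow_succ, mul_assoc, mul_one_div]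
    refine mul_le_of_le_one_right (by positivity) ((div_le_one (by positivity)).2 ?_)
    nlinarith [sq_nonneg (C₀ - 1)]
  · rw [← iteratedDeriv_succ', ← iteratedDeriv_succ', norm_iteratedDeriv_phiEx hC.le,
      add_assoc, pow_add, mul_assoc, mul_one_div]
    refine mul_le_of_le_one_right (by positivity) ((div_le_one (by positivity)).2 ?_)
    norm_num
end

section
/- Let C₁ > 0, C₂ ∈ ℝ with |C₂| ≤ C₁, and C₃ ∈ ℂ with Re C₃ ≤ 0, and set A(x) = e^{i C₂ x + C₃} for x ∈ ℝ. Let C₀ > 0 and let W, V : ℝ → ℂ be smooth functions satisfying ‖∂ₓⁿ W‖_{L^∞(ℝ)} ≤ C₀^{n+1} and ‖∂ₓⁿ V‖_{L^∞(ℝ)} ≤ C₀^{n+1} for all n ∈ ℕ₀. Then for every bounded smooth solution u : ℝ → ℂ of the divergence-form equation (A u')' = W u' + V u there exists a constant C > 0 such that ‖∂ₓⁿ u‖_{L^∞(ℝ)} ≤ C^{n+1} · n!/(log(n+e))ⁿ for all n ∈ ℕ₀. -/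
open Real

/-- The Touchard moment `∑ kⁿ / k!`, equal to `e` times the `n`-th Bell number. -/
noncomputable def dobinskiSum (n : ℕ) : ℝ := ∑' k : ℕ, (k : ℝ) ^ n / (k.factorial : ℝ)

lemma dobinskiSum_term_le (n k : ℕ) {R : ℝ} (hR : 0 < R) :
    (k : ℝ) ^ n / (k.factorial : ℝ) ≤
      (n.factorial : ℝ) / R ^ n * (Real.exp R ^ k / (k.factorial : ℝ)) := by
  have h := Real.pow_div_factorial_le_exp ((k : ℝ) * R) (by positivity) n
  rw [Real.exp_nat_mul, mul_pow, div_le_iff₀ (by positivity)] at h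
  have h' : (k : ℝ) ^ n ≤ (n.factorial : ℝ) / R ^ n * Real.exp R ^ k := by
    rw [div_mul_eq_mul_div, le_div_iff₀ (by positivity)]
    linarith
  calc (k : ℝ) ^ n / (k.factorial : ℝ)
      ≤ ((n.factorial : ℝ) / R ^ n * Real.exp R ^ k) / (k.factorial : ℝ) := by gcongr
    _ = _ := by ring

lemma summable_dobinskiSum (n : ℕ) :
    Summable fun k : ℕ => (k : ℝ) ^ n / (k.factorial : ℝ) :=
  Summable.of_nonneg_of_le (fun _ => by positivity)
    (fun k => dobinskiSum_term_le n k one_pos)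
    ((Real.summable_pow_div_factorial _).mul_left _)

lemma dobinskiSum_le (n : ℕ) {R : ℝ} (hR : 0 < R) :
    dobinskiSum n ≤ (n.factorial : ℝ) / R ^ n * Real.exp (Real.exp R) := by
  have h : Real.exp (Real.exp R) = ∑' k : ℕ, Real.exp R ^ k / (k.factorial : ℝ) := by
    rw [Real.exp_eq_exp_ℝ, NormedSpace.exp_eq_tsum_div]
  rw [h, ← tsum_mul_left]
  exact (summable_dobinskiSum n).tsum_le_tsum (fun k => dobinskiSum_term_le n k hR)
    ((Real.summable_pow_div_factorial _).mul_left _)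

lemma one_le_dobinskiSum (n : ℕ) : 1 ≤ dobinskiSum n := by
  simpa [dobinskiSum] using (summable_dobinskiSum n).le_tsum 1 (fun _ _ => by positivity)

lemma dobinskiSum_add_two (n : ℕ) :
    dobinskiSum (n + 2) = ∑ i ∈ Finset.range (n + 1),
      (n.choose i : ℝ) * (dobinskiSum (n - i + 1) + dobinskiSum (n - i)) := by
  have hsum : ∀ i, Summable fun k : ℕ => (n.choose i : ℝ) *
      ((k : ℝ) ^ (n - i + 1) / (k.factorial : ℝ) + (k : ℝ) ^ (n - i) / (k.factorial : ℝ)) :=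
    fun i => ((summable_dobinskiSum _).add (summable_dobinskiSum _)).mul_left _
  calc dobinskiSum (n + 2)
      = ∑' k : ℕ, ((k + 1 : ℕ) : ℝ) ^ (n + 2) / ((k + 1).factorial : ℝ) := by
        rw [dobinskiSum, (summable_dobinskiSum (n + 2)).tsum_eq_zero_add]
        simp
    _ = ∑' k : ℕ, ∑ i ∈ Finset.range (n + 1), (n.choose i : ℝ) *
          ((k : ℝ) ^ (n - i + 1) / (k.factorial : ℝ) + (k : ℝ) ^ (n - i) / (k.factorial : ℝ)) := by
        refine tsum_congr fun k => ?_
        have hk : (k.factorial : ℝ) ≠ 0 := by positivity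
        have hk1 : (k : ℝ) + 1 ≠ 0 := by positivity
        calc ((k + 1 : ℕ) : ℝ) ^ (n + 2) / ((k + 1).factorial : ℝ)
            = (1 + (k : ℝ)) ^ n * (((k : ℝ) + 1) / (k.factorial : ℝ)) := by
              rw [Nat.factorial_succ]
              push_cast
              field_simp
              ring
          _ = _ := by
              rw [add_pow, Finset.sum_mul]
              refine Finset.sum_congr rfl fun i _ => ?_
              rw [one_pow]
              ring
    _ = _ := by
        rw [Summable.tsum_finsetSum fun i _ => hsum i]
        refine Finset.sum_congr rfl fun i _ => ?_
        rw [tsum_mul_left, (summable_dobinskiSum _).tsum_add (summable_dobinskiSum _)]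
        rfl

lemma norm_iteratedDeriv_mul_le {f g : ℝ → ℂ} (hf : ContDiff ℝ (⊤ : ℕ∞) f)
    (hg : ContDiff ℝ (⊤ : ℕ∞) g) (n : ℕ) (x : ℝ) :
    ‖iteratedDeriv n (fun y => f y * g y) x‖ ≤ ∑ i ∈ Finset.range (n + 1),
      (n.choose i : ℝ) * ‖iteratedDeriv i f x‖ * ‖iteratedDeriv (n - i) g x‖ := by
  simpa only [norm_iteratedFDeriv_eq_norm_iteratedDeriv] using
    norm_iteratedFDeriv_mul_le hf hg x (n := n) (by exact_mod_cast le_top)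

lemma iteratedDeriv_cexp_affine (a b : ℂ) (n : ℕ) :
    iteratedDeriv n (fun y : ℝ => Complex.exp (a * y + b)) =
      fun y : ℝ => a ^ n * Complex.exp (a * y + b) := by
  induction n with
  | zero => simp
  | succ n ih =>
    rw [iteratedDeriv_succ, ih]
    funext y
    have h : HasDerivAt (fun y : ℝ => a * (y : ℂ) + b) a y := by
      simpa using ((Complex.ofRealCLM.hasDerivAt (x := y)).const_mul a).add_const b
    rw [(h.cexp.const_mul (a ^ n)).deriv]
    ring

lemma contDiff_cexp_affine (a b : ℂ) :
    ContDiff ℝ (⊤ : ℕ∞) (fun y : ℝ => Complex.exp (a * y + b)) :=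
  ((contDiff_const.mul Complex.ofRealCLM.contDiff).add contDiff_const).cexp

/-- A Landau-type inequality: a bounded function whose second derivative is controlled by the
first derivative has a bounded first derivative. -/
lemma norm_deriv_le_of_norm_deriv_deriv_le {u : ℝ → ℂ} (hu : ContDiff ℝ (⊤ : ℕ∞) u)
    {K L M : ℝ} (hK : 0 < K) (hL : 0 ≤ L) (hM : ∀ x, ‖u x‖ ≤ M)
    (h2 : ∀ x, ‖deriv (deriv u) x‖ ≤ K * ‖deriv u x‖ + L) (x : ℝ) :
    ‖deriv u x‖ ≤ 8 * M * K + L / K := by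
  have hdu : Differentiable ℝ u := hu.differentiable (by simp)
  have hu' : ContDiff ℝ (⊤ : ℕ∞) (deriv u) := by
    simpa using (contDiff_infty_iff_deriv.1 hu).2
  have hddu : Differentiable ℝ (deriv u) := hu'.differentiable (by simp)
  set h : ℝ := 1 / (2 * K) with hh
  have hpos : 0 < h := by positivity
  have hKh : K * h = 1 / 2 := by rw [hh]; field_simp
  have hx : x ∈ Set.Icc x (x + h) := ⟨le_rfl, by linarith⟩
  have hxh : x + h ∈ Set.Icc x (x + h) := ⟨by linarith, le_rfl⟩
  obtain ⟨y, hy, hmax⟩ := (isCompact_Icc (a := x) (b := x + h)).exists_isMaxOn ⟨x, hx⟩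
    hu'.continuous.norm.continuousOn
  set S := ‖deriv u y‖ with hS
  have hmax' : ∀ z ∈ Set.Icc x (x + h), ‖deriv u z‖ ≤ S := fun z hz => hmax hz
  have hosc : ∀ z ∈ Set.Icc x (x + h), ‖deriv u z - deriv u y‖ ≤ (K * S + L) * h := by
    intro z hz
    have h1 := (convex_Icc x (x + h)).norm_image_sub_le_of_norm_deriv_le (f := deriv u)
      (C := K * S + L) (fun w _ => hddu w)
      (fun w hw => (h2 w).trans (by have := hmax' w hw; gcongr)) hy hz
    refine h1.trans ?_
    have : ‖z - y‖ ≤ h := by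
      rw [Real.norm_eq_abs, abs_le]
      constructor <;> linarith [hz.1, hz.2, hy.1, hy.2]
    gcongr
  have hlin := (convex_Icc x (x + h)).norm_image_sub_le_of_norm_hasDerivWithin_le
    (f := fun z => u z - z • deriv u y) (f' := fun z => deriv u z - deriv u y)
    (C := (K * S + L) * h)
    (fun z _ => by
      have := ((hdu z).hasDerivAt.fun_sub ((hasDerivAt_id z).smul_const (deriv u y)))
      simpa using this.hasDerivWithinAt) hosc hx hxh
  have hkey : h * S ≤ 2 * M + (K * S + L) * h * h := by
    have e : h • deriv u y = (u (x + h) - u x) -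
        ((u (x + h) - (x + h) • deriv u y) - (u x - x • deriv u y)) := by
      rw [add_smul]; abel
    have hn : ‖h • deriv u y‖ = h * S := by rw [norm_smul, Real.norm_of_nonneg hpos.le]
    rw [← hn, e]
    refine (norm_sub_le _ _).trans (add_le_add ((norm_sub_le _ _).trans ?_) (hlin.trans ?_))
    · linarith [hM x, hM (x + h)]
    · rw [add_sub_cancel_left, Real.norm_of_nonneg hpos.le]
  have hfin : S ≤ 8 * M * K + L / K := by
    have e1 : (2 * K) * h = 1 := by linarith
    have e2 : S ≤ 4 * M * K + (K * S + L) * h := by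
      have := mul_le_mul_of_nonneg_left hkey (by positivity : 0 ≤ 2 * K)
      linear_combination this + ((K * S + L) * h - S) * e1
    have e3 : (K * S + L) * h = S / 2 + L / (2 * K) := by rw [hh]; field_simp
    have e4 : L / (2 * K) = L / K / 2 := by ring
    linarith
  exact (hmax' x hx).trans hfin

/-- Bounded solutions of `u'' = P u' + Q u` whose coefficients have at most exponentially growing
derivatives obey Bell-number bounds. -/
lemma norm_iteratedDeriv_le_dobinskiSum {u P Q : ℝ → ℂ} (hu : ContDiff ℝ (⊤ : ℕ∞) u)
    (hPs : ContDiff ℝ (⊤ : ℕ∞) P) (hQs : ContDiff ℝ (⊤ : ℕ∞) Q) {K B : ℝ} (hK : 1 ≤ K)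
    (hP : ∀ (n : ℕ) (x : ℝ), ‖iteratedDeriv n P x‖ ≤ K ^ (n + 1))
    (hQ : ∀ (n : ℕ) (x : ℝ), ‖iteratedDeriv n Q x‖ ≤ K ^ (n + 1))
    (heq : ∀ x, deriv (deriv u) x = P x * deriv u x + Q x * u x)
    (hB : ∀ x, ‖u x‖ ≤ B) (hB' : ∀ x, ‖deriv u x‖ ≤ B) (n : ℕ) (x : ℝ) :
    ‖iteratedDeriv n u x‖ ≤ B * K ^ n * dobinskiSum n := by
  have hu' : ContDiff ℝ (⊤ : ℕ∞) (deriv u) := (contDiff_infty_iff_deriv.1 hu).2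
  have hB0 : 0 ≤ B := (norm_nonneg _).trans (hB 0)
  have hK0 : 0 < K := by linarith
  have hd0 : ∀ n, 0 ≤ dobinskiSum n := fun n => zero_le_one.trans (one_le_dobinskiSum n)
  induction n using Nat.strong_induction_on with
  | _ n ih =>
    match n, ih with
    | 0, _ =>
      rw [iteratedDeriv_zero, pow_zero, mul_one]
      exact (hB x).trans (le_mul_of_one_le_right hB0 (one_le_dobinskiSum 0))
    | 1, _ =>
      rw [iteratedDeriv_one, pow_one]
      refine (hB' x).trans ((le_mul_of_one_le_right hB0 hK).trans ?_)
      exact le_mul_of_one_le_right (by positivity) (one_le_dobinskiSum 1)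
    | n + 2, ih =>
      have e : iteratedDeriv (n + 2) u x =
          iteratedDeriv n (fun y => P y * deriv u y) x + iteratedDeriv n (fun y => Q y * u y) x := by
        rw [iteratedDeriv_succ', iteratedDeriv_succ', funext heq]
        exact iteratedDeriv_fun_add
          ((hPs.mul hu').of_le (by exact_mod_cast le_top)).contDiffAt
          ((hQs.mul hu).of_le (by exact_mod_cast le_top)).contDiffAt
      rw [e]
      refine (norm_add_le _ _).trans ((add_le_add (norm_iteratedDeriv_mul_le hPs hu' n x)
        (norm_iteratedDeriv_mul_le hQs hu n x)).trans ?_)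
      rw [dobinskiSum_add_two, ← Finset.sum_add_distrib, Finset.mul_sum]
      refine Finset.sum_le_sum fun i hi => ?_
      have hi' : i ≤ n := Nat.lt_succ_iff.1 (Finset.mem_range.1 hi)
      have h1 : ‖iteratedDeriv (n - i) (deriv u) x‖ ≤
          B * K ^ (n - i + 1) * dobinskiSum (n - i + 1) := by
        rw [← iteratedDeriv_succ']
        exact ih _ (by omega)
      have h0 : ‖iteratedDeriv (n - i) u x‖ ≤ B * K ^ (n - i + 1) * dobinskiSum (n - i) := by
        refine (ih _ (by omega)).trans ?_
        have := hd0 (n - i)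
        gcongr
        omega
      have hpow : K ^ (n + 2) = K ^ (i + 1) * K ^ (n - i + 1) := by
        rw [← pow_add]; congr 1; omega
      calc _ ≤ (n.choose i : ℝ) * K ^ (i + 1) * (B * K ^ (n - i + 1) * dobinskiSum (n - i + 1)) +
            (n.choose i : ℝ) * K ^ (i + 1) * (B * K ^ (n - i + 1) * dobinskiSum (n - i)) := by
            have := hP i x
            have := hQ i x
            gcongr
        _ = _ := by rw [hpow]; ring

lemma norm_iteratedDeriv_cexp_mul_le {a b : ℂ} {c C₀ : ℝ} (ha : ‖a‖ ≤ c) (hre : a.re = 0)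
    {W : ℝ → ℂ} (hWs : ContDiff ℝ (⊤ : ℕ∞) W)
    (hW : ∀ (n : ℕ) (x : ℝ), ‖iteratedDeriv n W x‖ ≤ C₀ ^ (n + 1)) (n : ℕ) (x : ℝ) :
    ‖iteratedDeriv n (fun y : ℝ => Complex.exp (a * y + b) * W y) x‖ ≤
      Real.exp b.re * C₀ * (c + C₀) ^ n := by
  refine (norm_iteratedDeriv_mul_le (contDiff_cexp_affine a b) hWs n x).trans ?_
  rw [add_pow, Finset.mul_sum]
  refine Finset.sum_le_sum fun i _ => ?_
  have hE : ‖iteratedDeriv i (fun y : ℝ => Complex.exp (a * y + b)) x‖ ≤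
      c ^ i * Real.exp b.re := by
    rw [iteratedDeriv_cexp_affine, norm_mul, norm_pow, Complex.norm_exp]
    simp only [Complex.add_re, Complex.mul_re, Complex.ofReal_re, Complex.ofReal_im, hre,
      zero_mul, mul_zero, sub_zero, zero_add]
    gcongr
  have hc : 0 ≤ c := (norm_nonneg _).trans ha
  calc _ ≤ (n.choose i : ℝ) * (c ^ i * Real.exp b.re) * C₀ ^ (n - i + 1) := by
        have := hW (n - i) x
        gcongr
    _ = _ := by ring

/-- **Ultra-analyticity for the divergence-form equation with leading coefficient
`A(x) = e^{iC₂x+C₃}`** (the implication (ii) ⟹ (i) of Proposition 2.7): if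
`|C₂| ≤ C₁`, `Re C₃ ≤ 0`, and `W, V` satisfy `‖∂ₓⁿW‖_∞, ‖∂ₓⁿV‖_∞ ≤ C₀^{n+1}`,
then every bounded smooth solution `u` of `(A u')' = W u' + V u` satisfies
`‖∂ₓⁿ u‖_∞ ≤ C^{n+1} n!/(log(n+e))ⁿ` for some constant `C > 0`. -/
theorem divergence_form_ultra_analytic
    (C₁ : ℝ) (hC₁ : 0 < C₁) (C₂ : ℝ) (hC₂ : |C₂| ≤ C₁) (C₃ : ℂ) (hC₃ : C₃.re ≤ 0)
    (C₀ : ℝ) (hC₀ : 0 < C₀) (W V : ℝ → ℂ)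
    (hWs : ContDiff ℝ (⊤ : ℕ∞) W) (hVs : ContDiff ℝ (⊤ : ℕ∞) V)
    (hW : ∀ (n : ℕ) (x : ℝ), ‖iteratedDeriv n W x‖ ≤ C₀ ^ (n + 1))
    (hV : ∀ (n : ℕ) (x : ℝ), ‖iteratedDeriv n V x‖ ≤ C₀ ^ (n + 1))
    (u : ℝ → ℂ) (hu : ContDiff ℝ (⊤ : ℕ∞) u) (hub : ∃ M : ℝ, ∀ x : ℝ, ‖u x‖ ≤ M)
    (heq : ∀ x : ℝ,
      deriv (fun y : ℝ =>
        Complex.exp (Complex.I * (C₂ : ℂ) * (y : ℂ) + C₃) * deriv u y) x =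
      W x * deriv u x + V x * u x) :
    ∃ Cc : ℝ, 0 < Cc ∧ ∀ (n : ℕ) (x : ℝ),
      ‖iteratedDeriv n u x‖ ≤
        Cc ^ (n + 1) * (Nat.factorial n : ℝ) /
          Real.log ((n : ℝ) + Real.exp 1) ^ n := by
  obtain ⟨M, hM⟩ := hub
  have hu' : ContDiff ℝ (⊤ : ℕ∞) (deriv u) := (contDiff_infty_iff_deriv.1 hu).2
  have hM0 : 0 ≤ M := (norm_nonneg _).trans (hM 0)
  set a : ℂ := -(Complex.I * (C₂ : ℂ)) with ha
  have ha_re : a.re = 0 := by simp [ha]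
  have ha_norm : ‖a‖ ≤ C₁ := by simpa [ha] using hC₂
  set E : ℝ → ℂ := fun y => Complex.exp (a * y + -C₃) with hE
  set G : ℝ := Real.exp (-C₃).re with hG
  have hG0 : 0 < G := Real.exp_pos _
  set K : ℝ := (G + 1) * (C₁ + C₀) + 1 with hKdef
  have hK : 1 ≤ K := by
    have : 0 ≤ (G + 1) * (C₁ + C₀) := by positivity
    linarith
  have hK0 : 0 < K := by linarith
  have hEs : ContDiff ℝ (⊤ : ℕ∞) E := contDiff_cexp_affine a (-C₃)
  have hKpow : ∀ n : ℕ, (G * C₀ + C₁) * (C₁ + C₀) ^ n ≤ K ^ (n + 1) := by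
    intro n
    rw [pow_succ']
    have h1 : G * C₀ + C₁ ≤ K := by
      rw [hKdef]
      nlinarith [mul_pos hG0 hC₁]
    have h2 : C₁ + C₀ ≤ K := by
      rw [hKdef]
      nlinarith [mul_pos hG0 hC₁, mul_pos hG0 hC₀]
    gcongr
  have hPs : ContDiff ℝ (⊤ : ℕ∞) (fun y => E y * W y + a) := (hEs.mul hWs).add contDiff_const
  have hQs : ContDiff ℝ (⊤ : ℕ∞) (fun y => E y * V y) := hEs.mul hVs
  have hP : ∀ (n : ℕ) (x : ℝ), ‖iteratedDeriv n (fun y => E y * W y + a) x‖ ≤ K ^ (n + 1) := by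
    intro n x
    refine le_trans ?_ (hKpow n)
    rw [iteratedDeriv_fun_add ((hEs.mul hWs).of_le (by exact_mod_cast le_top)).contDiffAt
      contDiff_const.contDiffAt, add_mul]
    refine (norm_add_le _ _).trans (add_le_add
      (norm_iteratedDeriv_cexp_mul_le ha_norm ha_re hWs hW n x) ?_)
    rw [iteratedDeriv_const]
    split_ifs with hn
    · simpa [hn] using ha_norm
    · rw [norm_zero]; positivity
  have hQ : ∀ (n : ℕ) (x : ℝ), ‖iteratedDeriv n (fun y => E y * V y) x‖ ≤ K ^ (n + 1) := by
    intro n x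
    refine (norm_iteratedDeriv_cexp_mul_le ha_norm ha_re hVs hV n x).trans
      (le_trans ?_ (hKpow n))
    gcongr
    linarith
  have hode : ∀ x, deriv (deriv u) x = (E x * W x + a) * deriv u x + E x * V x * u x := by
    intro x
    have hA : HasDerivAt (fun y : ℝ => Complex.exp (Complex.I * (C₂ : ℂ) * (y : ℂ) + C₃))
        (-a * Complex.exp (Complex.I * (C₂ : ℂ) * (x : ℂ) + C₃)) x := by
      have h : HasDerivAt (fun y : ℝ => Complex.I * (C₂ : ℂ) * (y : ℂ) + C₃)
          (Complex.I * (C₂ : ℂ)) x := by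
        simpa using
          ((Complex.ofRealCLM.hasDerivAt (x := x)).const_mul (Complex.I * (C₂ : ℂ))).add_const C₃
      convert h.cexp using 1
      rw [ha]; ring
    have h := heq x
    rw [(hA.fun_mul (hu'.differentiable (by simp) x).hasDerivAt).deriv] at h
    have hinv : E x * Complex.exp (Complex.I * (C₂ : ℂ) * (x : ℂ) + C₃) = 1 := by
      rw [hE, ← Complex.exp_add, ← Complex.exp_zero]
      congr 1
      rw [ha]; ring
    linear_combination E x * h + (a * deriv u x - deriv (deriv u) x) * hinv
  have h2 : ∀ x, ‖deriv (deriv u) x‖ ≤ K * ‖deriv u x‖ + K * M := by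
    intro x
    have hp : ‖E x * W x + a‖ ≤ K := by simpa using hP 0 x
    have hq : ‖E x * V x‖ ≤ K := by simpa only [iteratedDeriv_zero, zero_add, pow_one] using hQ 0 x
    rw [hode x]
    refine (norm_add_le _ _).trans ?_
    rw [norm_mul, norm_mul (E x * V x)]
    have := hM x
    gcongr
  have h1 := norm_deriv_le_of_norm_deriv_deriv_le hu hK0 (by positivity) hM h2
  set B : ℝ := 8 * M * K + K * M / K + M with hB
  have hKM : 0 ≤ K * M / K := by positivity
  have hMK : 0 ≤ 8 * M * K := by positivity
  have hB0 : 0 ≤ B := by positivity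
  have hbound := norm_iteratedDeriv_le_dobinskiSum hu hPs hQs hK hP hQ hode (B := B)
    (fun x => (hM x).trans (by linarith)) (fun x => (h1 x).trans (by linarith))
  set D : ℝ := B * Real.exp (Real.exp 1) + 1 with hD
  have hD1 : 1 ≤ D := by
    have : 0 ≤ B * Real.exp (Real.exp 1) := by positivity
    linarith
  have hKe : 1 ≤ K * Real.exp 1 := one_le_mul_of_one_le_of_one_le hK (by simp)
  refine ⟨D * (K * Real.exp 1), by positivity, fun n x => (hbound n x).trans ?_⟩
  have he : 0 < (n : ℝ) + Real.exp 1 := by positivity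
  have hR : 0 < Real.log ((n : ℝ) + Real.exp 1) := by
    apply Real.log_pos
    have := Real.add_one_le_exp (1 : ℝ)
    have : (0 : ℝ) ≤ n := n.cast_nonneg
    linarith
  have hd := dobinskiSum_le n hR
  rw [Real.exp_log he] at hd
  calc B * K ^ n * dobinskiSum n
      ≤ B * K ^ n * ((n.factorial : ℝ) / Real.log ((n : ℝ) + Real.exp 1) ^ n *
          Real.exp ((n : ℝ) + Real.exp 1)) := by gcongr
    _ = (B * Real.exp (Real.exp 1)) * (K * Real.exp 1) ^ n * (n.factorial : ℝ) /
          Real.log ((n : ℝ) + Real.exp 1) ^ n := by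
        rw [Real.exp_add, mul_pow, ← Real.exp_nat_mul, mul_one]
        ring
    _ ≤ (D * (K * Real.exp 1)) ^ (n + 1) * (n.factorial : ℝ) /
          Real.log ((n : ℝ) + Real.exp 1) ^ n := by
        rw [mul_pow D]
        have hDn : B * Real.exp (Real.exp 1) ≤ D ^ (n + 1) :=
          (by linarith : B * Real.exp (Real.exp 1) ≤ D).trans (le_self_pow₀ hD1 n.succ_ne_zero)
        have hKn : (K * Real.exp 1) ^ n ≤ (K * Real.exp 1) ^ (n + 1) :=
          pow_le_pow_right₀ hKe n.le_succ
        gcongr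
end

section
/- Let d ≥ 1. There exists a constant c = c(d) > 0 such that for every smooth function u : ℝᵈ → ℂ with u ∈ L¹(ℝᵈ) and Δu ∈ L¹(ℝᵈ), one has ‖∇u‖_{L¹(ℝᵈ)} ≤ c ‖u − Δu‖_{L¹(ℝᵈ)}; consequently, for every ε > 0, ‖∇u‖_{L¹(ℝᵈ)} ≤ c (ε ‖Δu‖_{L¹(ℝᵈ)} + ε^{−1} ‖u‖_{L¹(ℝᵈ)}). -/
open MeasureTheory Real
open scoped ENNReal

/-- The partial derivative `∂/∂xᵢ` of a function on `ℝᵈ`. -/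
noncomputable def partialDeriv' {d : ℕ} (i : Fin d) (u : (Fin d → ℝ) → ℂ) :
    (Fin d → ℝ) → ℂ :=
  fun x => fderiv ℝ u x (Pi.single i 1)

/-- The Laplacian `Δu = ∑ᵢ ∂²u/∂xᵢ²` of a function on `ℝᵈ`. -/
noncomputable def laplacian' {d : ℕ} (u : (Fin d → ℝ) → ℂ) : (Fin d → ℝ) → ℂ :=
  fun x => ∑ i, partialDeriv' i (partialDeriv' i u) x

/-- The pointwise Euclidean length `|∇u(x)|` of the gradient. -/
noncomputable def gradLen {d : ℕ} (u : (Fin d → ℝ) → ℂ) : (Fin d → ℝ) → ℝ :=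
  fun x => Real.sqrt (∑ i, ‖partialDeriv' i u x‖ ^ 2)

open Set in
theorem exists_antideriv_profile {χ : ℝ → ℝ} (hχ : Continuous χ) (hpos : ∀ s < 1, 0 < χ s)
    (hzero : ∀ s, 1 ≤ s → χ s = 0) :
    ∃ g : ℝ → ℝ, ContDiff ℝ 1 g ∧ (∀ s < 1, 0 < g s) ∧ (∀ s, 1 ≤ s → g s = 0) ∧
      ∀ s, HasDerivAt g (-(χ s / 2)) s := by
  have hderiv : ∀ s, HasDerivAt (fun s => ∫ r in s..1, χ r / 2) (-(χ s / 2)) s := fun s =>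
    intervalIntegral.integral_hasDerivAt_left ((hχ.div_const 2).intervalIntegrable _ _)
      ((hχ.div_const 2).stronglyMeasurableAtFilter _ _) (hχ.div_const 2).continuousAt
  refine ⟨fun s => ∫ r in s..1, χ r / 2, ?_, ?_, ?_, hderiv⟩
  · rw [contDiff_one_iff_deriv]
    refine ⟨fun s => (hderiv s).differentiableAt, ?_⟩
    rw [show deriv (fun s => ∫ r in s..1, χ r / 2) = fun s => -(χ s / 2) from
      funext fun s => (hderiv s).deriv]
    fun_prop
  · intro s hs
    refine intervalIntegral.intervalIntegral_pos_of_pos_on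
      ((hχ.div_const 2).intervalIntegrable _ _) (fun r hr => ?_) hs
    have := hpos r hr.2
    positivity
  · intro s hs
    have : ∫ r in s..1, χ r / 2 = ∫ r in s..1, (0 : ℝ) := by
      refine intervalIntegral.integral_congr fun r hr => ?_
      rw [uIcc_of_ge hs] at hr
      simp [hzero r hr.1]
    simpa using this

/-- The radial function on `ℝᵈ` with profile `χ` in the squared Euclidean length. -/
def radialKernel {d : ℕ} (χ : ℝ → ℝ) (y : Fin d → ℝ) : ℝ := χ (∑ j, y j ^ 2)

theorem radialKernel_contDiff {d : ℕ} {χ : ℝ → ℝ} (hχ : ContDiff ℝ 1 χ) :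
    ContDiff ℝ 1 (radialKernel (d := d) χ) := by
  unfold radialKernel
  fun_prop

theorem radialKernel_hasCompactSupport {d : ℕ} {χ : ℝ → ℝ} (hzero : ∀ s, 1 ≤ s → χ s = 0) :
    HasCompactSupport (radialKernel (d := d) χ) := by
  refine HasCompactSupport.of_support_subset_isCompact (isCompact_closedBall (0 : Fin d → ℝ) 1) ?_
  intro y hy
  rw [mem_closedBall_zero_iff, pi_norm_le_iff_of_nonneg zero_le_one]
  intro i
  have h1 : ∑ j, y j ^ 2 < 1 := by
    by_contra! h
    exact hy (hzero _ h)
  have h2 : y i ^ 2 ≤ ∑ j, y j ^ 2 :=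
    Finset.single_le_sum (f := fun j => y j ^ 2) (fun j _ => sq_nonneg _) (Finset.mem_univ i)
  rw [Real.norm_eq_abs, ← sq_le_one_iff_abs_le_one]
  linarith

theorem radialKernel_nonneg {d : ℕ} {χ : ℝ → ℝ} (hpos : ∀ s < 1, 0 < χ s)
    (hzero : ∀ s, 1 ≤ s → χ s = 0) (y : Fin d → ℝ) : 0 ≤ radialKernel χ y := by
  rcases lt_or_ge (∑ j, y j ^ 2) 1 with h | h
  · exact (hpos _ h).le
  · exact (hzero _ h).ge

theorem radialKernel_integral_pos {d : ℕ} {χ : ℝ → ℝ} (hχ : ContDiff ℝ 1 χ)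
    (hpos : ∀ s < 1, 0 < χ s) (hzero : ∀ s, 1 ≤ s → χ s = 0) :
    0 < ∫ y : Fin d → ℝ, radialKernel χ y := by
  refine (radialKernel_contDiff hχ).continuous.integral_pos_of_hasCompactSupport_nonneg_nonzero
    (radialKernel_hasCompactSupport hzero) (radialKernel_nonneg hpos hzero) (x := 0) ?_
  have := hpos 0 one_pos
  simpa [radialKernel] using this.ne'

theorem radialKernel_fderiv {d : ℕ} {χ g : ℝ → ℝ} (hg : ∀ s, HasDerivAt g (-(χ s / 2)) s)
    (y : Fin d → ℝ) (j : Fin d) :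
    fderiv ℝ (radialKernel g) y (Pi.single j 1) = -(y j * radialKernel χ y) := by
  have h1 : HasFDerivAt (fun y : Fin d → ℝ => ∑ j, y j ^ 2)
      (∑ j, (2 * y j) • ContinuousLinearMap.proj (R := ℝ) (φ := fun _ : Fin d => ℝ) j) y := by
    refine HasFDerivAt.fun_sum fun i _ => ?_
    simpa using (ContinuousLinearMap.proj (R := ℝ) (φ := fun _ : Fin d => ℝ) i).hasFDerivAt.pow 2
  have h2 := (hg (∑ j, y j ^ 2)).comp_hasFDerivAt y h1
  have h3 : fderiv ℝ (radialKernel g) y = _ := h2.fderiv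
  rw [h3]
  simp [Pi.single_apply, radialKernel]
  ring

/-- A nonnegative, nontrivial, compactly supported kernel of class `C¹`. -/
structure IsC1Kernel {d : ℕ} (k : (Fin d → ℝ) → ℝ) : Prop where
  contDiff : ContDiff ℝ 1 k
  hasCompactSupport : HasCompactSupport k
  nonneg : ∀ y, 0 ≤ k y
  integral_pos : 0 < ∫ y, k y

theorem isC1Kernel_radialKernel {d : ℕ} {χ : ℝ → ℝ} (hχ : ContDiff ℝ 1 χ)
    (hpos : ∀ s < 1, 0 < χ s) (hzero : ∀ s, 1 ≤ s → χ s = 0) :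
    IsC1Kernel (radialKernel (d := d) χ) :=
  ⟨radialKernel_contDiff hχ, radialKernel_hasCompactSupport hzero, radialKernel_nonneg hpos hzero,
    radialKernel_integral_pos hχ hpos hzero⟩

theorem exists_isC1Kernel_chain (d : ℕ) :
    ∃ k₀ k₁ k₂ : (Fin d → ℝ) → ℝ, IsC1Kernel k₀ ∧ IsC1Kernel k₁ ∧ IsC1Kernel k₂ ∧
      (∀ y j, fderiv ℝ k₁ y (Pi.single j 1) = -(y j * k₀ y)) ∧
      (∀ y j, fderiv ℝ k₂ y (Pi.single j 1) = -(y j * k₁ y)) := by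
  have hχ : ContDiff ℝ 1 (fun s => expNegInvGlue (1 - s)) :=
    (expNegInvGlue.contDiff (n := 1)).comp (by fun_prop)
  have hχp : ∀ s : ℝ, s < 1 → 0 < expNegInvGlue (1 - s) := fun s hs =>
    expNegInvGlue.pos_of_pos (by linarith)
  have hχz : ∀ s : ℝ, 1 ≤ s → expNegInvGlue (1 - s) = 0 := fun s hs =>
    expNegInvGlue.zero_of_nonpos (by linarith)
  obtain ⟨g, hg, hgp, hgz, hgd⟩ := exists_antideriv_profile hχ.continuous hχp hχz
  obtain ⟨h, hh, hhp, hhz, hhd⟩ := exists_antideriv_profile hg.continuous hgp hgz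
  exact ⟨radialKernel fun s => expNegInvGlue (1 - s), radialKernel g, radialKernel h,
    isC1Kernel_radialKernel hχ hχp hχz, isC1Kernel_radialKernel hg hgp hgz,
    isC1Kernel_radialKernel hh hhp hhz, radialKernel_fderiv hgd, radialKernel_fderiv hhd⟩

/-- The average `∫ k(y) v(x - t y) dy` of `v` against the kernel `k` dilated by `t`. -/
noncomputable def dilatedConv {d : ℕ} (k : (Fin d → ℝ) → ℝ) (v : (Fin d → ℝ) → ℂ) (t : ℝ)
    (x : Fin d → ℝ) : ℂ :=
  ∫ y, k y • v (x - t • y)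

section dilatedConv

variable {d : ℕ} {k k' : (Fin d → ℝ) → ℝ} {v w : (Fin d → ℝ) → ℂ}

theorem dilatedConv_integrable (hk : Continuous k) (hks : HasCompactSupport k)
    (hv : Continuous v) (t : ℝ) (x : Fin d → ℝ) :
    Integrable (fun y => k y • v (x - t • y)) :=
  Continuous.integrable_of_hasCompactSupport (by fun_prop) hks.smul_right

theorem dilatedConv_continuous (hk : Continuous k) (hks : HasCompactSupport k)
    (hv : Continuous v) :
    Continuous fun p : ℝ × (Fin d → ℝ) => dilatedConv k v p.1 p.2 := by
  rw [← continuousOn_univ]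
  refine continuousOn_integral_of_compact_support (k := tsupport k)
    (f := fun (p : ℝ × (Fin d → ℝ)) (y : Fin d → ℝ) => k y • v (p.2 - p.1 • y)) hks ?_ ?_
  · refine Continuous.continuousOn ?_
    simp only [Function.uncurry_def]
    fun_prop
  · intro p y _ hy
    simp [image_eq_zero_of_notMem_tsupport hy]

theorem lintegral_dilatedConv_le (hk : Continuous k) (hv : Continuous v) (t : ℝ) :
    ∫⁻ x, ‖dilatedConv k v t x‖ₑ ≤ (∫⁻ y, ‖k y‖ₑ) * ∫⁻ x, ‖v x‖ₑ := by
  calc ∫⁻ x, ‖dilatedConv k v t x‖ₑ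
      ≤ ∫⁻ x, ∫⁻ y, ‖k y‖ₑ * ‖v (x - t • y)‖ₑ := by
        refine lintegral_mono fun x => (enorm_integral_le_lintegral_enorm _).trans_eq ?_
        simp only [enorm_smul]
    _ = ∫⁻ y, ∫⁻ x, ‖k y‖ₑ * ‖v (x - t • y)‖ₑ := by
        refine lintegral_lintegral_swap (Measurable.aemeasurable ?_)
        exact (hk.comp continuous_snd).measurable.enorm.mul
          (hv.comp (continuous_fst.sub (continuous_snd.const_smul t))).measurable.enorm
    _ = ∫⁻ y, ‖k y‖ₑ * ∫⁻ x, ‖v x‖ₑ := by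
        refine lintegral_congr fun y => ?_
        rw [lintegral_const_mul' _ _ enorm_ne_top, lintegral_sub_right_eq_self (fun x => ‖v x‖ₑ)]
    _ = _ := by rw [lintegral_mul_const _ (by fun_prop)]

theorem dilatedConv_sub (hk : Continuous k) (hks : HasCompactSupport k)
    (hv : Continuous v) (hw : Continuous w) (t : ℝ) (x : Fin d → ℝ) :
    dilatedConv k (fun x => v x - w x) t x = dilatedConv k v t x - dilatedConv k w t x := by
  simp only [dilatedConv, smul_sub]
  exact integral_sub (dilatedConv_integrable hk hks hv t x) (dilatedConv_integrable hk hks hw t x)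

/-- Integration by parts. -/
theorem dilatedConv_fderiv (hk : ContDiff ℝ 1 k) (hks : HasCompactSupport k)
    (hw : ContDiff ℝ 1 w) (j : Fin d) (t : ℝ) (x : Fin d → ℝ) :
    dilatedConv (fun y => fderiv ℝ k y (Pi.single j 1)) w t x =
      t • dilatedConv k (partialDeriv' j w) t x := by
  have hk' : Continuous fun y => fderiv ℝ k y (Pi.single j 1) :=
    (hk.continuous_fderiv one_ne_zero).clm_apply continuous_const
  have hks' : HasCompactSupport fun y => fderiv ℝ k y (Pi.single j 1) :=
    hks.fderiv_apply (𝕜 := ℝ) _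
  have hw' : Continuous (partialDeriv' j w) :=
    (hw.continuous_fderiv one_ne_zero).clm_apply continuous_const
  have hder : ∀ y, HasFDerivAt (fun y : Fin d → ℝ => w (x - t • y))
      ((fderiv ℝ w (x - t • y)).comp (-(t • ContinuousLinearMap.id ℝ (Fin d → ℝ)))) y := by
    intro y
    refine ((hw.differentiable one_ne_zero _).hasFDerivAt).comp y ?_
    exact ((hasFDerivAt_id y).const_smul t).const_sub x
  have hder' : ∀ y, fderiv ℝ (fun y : Fin d → ℝ => w (x - t • y)) y (Pi.single j 1) =
      -(t • partialDeriv' j w (x - t • y)) := by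
    intro y
    rw [(hder y).fderiv]
    simp [partialDeriv']
  have h := integral_smul_fderiv_eq_neg_fderiv_smul_of_integrable (μ := volume)
    (f := k) (g := fun y : Fin d → ℝ => w (x - t • y)) (v := Pi.single j 1)
    (dilatedConv_integrable hk' hks' hw.continuous t x)
    (by
      simp only [hder']
      refine Continuous.integrable_of_hasCompactSupport ?_ hks.smul_right
      have := hk.continuous
      fun_prop)
    (dilatedConv_integrable hk.continuous hks hw.continuous t x)
    (fun y _ => hk.differentiable one_ne_zero y)
    (fun y _ => (hder y).differentiableAt)
  simp only [hder', smul_neg, integral_neg, neg_inj] at h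
  simp only [dilatedConv]
  rw [← h, ← integral_smul]
  exact integral_congr_ae (.of_forall fun y => smul_comm _ _ _)

theorem partialDeriv'_contDiff {m n : WithTop ℕ∞} (hv : ContDiff ℝ n v) (hmn : m + 1 ≤ n)
    (j : Fin d) : ContDiff ℝ m (partialDeriv' j v) :=
  (hv.fderiv_right hmn).clm_apply contDiff_const

theorem partialDeriv'_comm (hv : ContDiff ℝ 2 v) (i j : Fin d) :
    partialDeriv' i (partialDeriv' j v) = partialDeriv' j (partialDeriv' i v) := by
  have hd : Differentiable ℝ (fderiv ℝ v) :=
    (hv.fderiv_right (m := 1) (by norm_num)).differentiable one_ne_zero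
  have key : ∀ a b : Fin d, ∀ x, partialDeriv' a (partialDeriv' b v) x =
      fderiv ℝ (fderiv ℝ v) x (Pi.single a 1) (Pi.single b 1) := by
    intro a b x
    have := ((hd x).hasFDerivAt.clm_apply
      (hasFDerivAt_const (Pi.single b (1 : ℝ) : Fin d → ℝ) x)).fderiv
    unfold partialDeriv'
    rw [this]
    simp
  ext x
  rw [key, key]
  exact (hv.contDiffAt.isSymmSndFDerivAt (by simp)).eq _ _

theorem laplacian'_continuous (hv : ContDiff ℝ 2 v) : Continuous (laplacian' v) := by
  refine continuous_finsetSum _ fun i _ => ?_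
  have h1 : ContDiff ℝ 1 (partialDeriv' i v) := partialDeriv'_contDiff hv (by norm_num) i
  exact (partialDeriv'_contDiff (m := 0) h1 (by norm_num) i).continuous

theorem laplacian'_partialDeriv' (hv : ContDiff ℝ 3 v) (i : Fin d) :
    laplacian' (partialDeriv' i v) = partialDeriv' i (laplacian' v) := by
  have hv2 : ContDiff ℝ 2 v := hv.of_le (by norm_num)
  have h2 : ∀ j, ContDiff ℝ 2 (partialDeriv' j v) := fun j =>
    partialDeriv'_contDiff hv (by norm_num) j
  have h1 : ∀ j, ContDiff ℝ 1 (partialDeriv' j (partialDeriv' j v)) := fun j =>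
    partialDeriv'_contDiff (h2 j) (by norm_num) j
  ext x
  have : partialDeriv' i (laplacian' v) x =
      ∑ j, partialDeriv' i (partialDeriv' j (partialDeriv' j v)) x := by
    have h : fderiv ℝ (laplacian' v) x = _ := (HasFDerivAt.fun_sum (u := Finset.univ) fun j _ =>
      ((h1 j).differentiable one_ne_zero x).hasFDerivAt).fderiv
    simp only [partialDeriv'] at h ⊢
    simp [h]
  rw [this]
  refine Finset.sum_congr rfl fun j _ => ?_
  rw [partialDeriv'_comm hv2 j i, partialDeriv'_comm (h2 j) j i]

theorem fderiv_apply_eq_sum_partialDeriv' (x y : Fin d → ℝ) :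
    fderiv ℝ v x y = ∑ j, y j • partialDeriv' j v x := by
  conv_lhs => rw [pi_eq_sum_univ' y, map_sum]
  simp only [map_smul, partialDeriv']

/-- If `∇k' = - y k`, then the average against `k` differs from a multiple of the value by an
integral of averages of the Laplacian against `k'`. -/
theorem dilatedConv_sub_integral_smul (hk : Continuous k) (hks : HasCompactSupport k)
    (hk' : ContDiff ℝ 1 k') (hks' : HasCompactSupport k')
    (hkk' : ∀ y j, fderiv ℝ k' y (Pi.single j 1) = -(y j * k y))
    (hv : ContDiff ℝ 2 v) (ε : ℝ) (x : Fin d → ℝ) :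
    dilatedConv k v ε x - (∫ y, k y) • v x =
      ∫ t in (0 : ℝ)..ε, t • dilatedConv k' (laplacian' v) t x := by
  have hv0 : Continuous v := hv.continuous
  have hpd : ∀ j, ContDiff ℝ 1 (partialDeriv' j v) := fun j =>
    partialDeriv'_contDiff hv (by norm_num) j
  have hpd2 : ∀ j, Continuous (partialDeriv' j (partialDeriv' j v)) := fun j =>
    (partialDeriv'_contDiff (m := 0) (hpd j) (by norm_num) j).continuous
  have hfd : Continuous (fderiv ℝ v) := hv.continuous_fderiv two_ne_zero
  have hfd' : ∀ (t : ℝ) y, HasDerivAt (fun t : ℝ => v (x - t • y))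
      (-(fderiv ℝ v (x - t • y) y)) t := by
    intro t y
    have h1 : HasDerivAt (fun t : ℝ => x - t • y) (-y) t := by
      simpa using ((hasDerivAt_id t).smul_const y).const_sub x
    rw [← map_neg]
    exact ((hv.differentiable two_ne_zero _).hasFDerivAt).comp_hasDerivAt t h1
  have hftc : ∀ y, v (x - ε • y) - v x = ∫ t in (0 : ℝ)..ε, -(fderiv ℝ v (x - t • y) y) := by
    intro y
    rw [intervalIntegral.integral_eq_sub_of_hasDerivAt (fun t _ => hfd' t y)]
    · simp
    · refine Continuous.intervalIntegrable ?_ _ _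
      fun_prop
  calc dilatedConv k v ε x - (∫ y, k y) • v x
      = ∫ y, k y • (v (x - ε • y) - v x) := by
        simp only [dilatedConv, smul_sub]
        rw [integral_sub (dilatedConv_integrable hk hks hv0 ε x), integral_smul_const]
        exact (hk.integrable_of_hasCompactSupport hks).smul_const _
    _ = ∫ y, ∫ t in (0 : ℝ)..ε, k y • -(fderiv ℝ v (x - t • y) y) := by
        refine integral_congr_ae (.of_forall fun y => ?_)
        simp only [hftc, intervalIntegral.integral_smul]
    _ = ∫ t in (0 : ℝ)..ε, ∫ y, k y • -(fderiv ℝ v (x - t • y) y) := by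
        refine (intervalIntegral_integral_swap ?_).symm
        have hc : Continuous (Function.uncurry fun (t : ℝ) (y : Fin d → ℝ) =>
            k y • -(fderiv ℝ v (x - t • y) y)) := by
          simp only [Function.uncurry_def]
          fun_prop
        have h1 : IntegrableOn (Function.uncurry fun (t : ℝ) (y : Fin d → ℝ) =>
            k y • -(fderiv ℝ v (x - t • y) y)) (Set.uIcc 0 ε ×ˢ tsupport k)
            (volume.prod volume) :=
          hc.continuousOn.integrableOn_compact (isCompact_uIcc.prod hks)
        have h2 : IntegrableOn (Function.uncurry fun (t : ℝ) (y : Fin d → ℝ) =>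
            k y • -(fderiv ℝ v (x - t • y) y)) (Set.uIcc 0 ε ×ˢ Set.univ)
            (volume.prod volume) := by
          refine h1.of_forall_sdiff_eq_zero (measurableSet_uIcc.prod MeasurableSet.univ) ?_
          rintro ⟨t, y⟩ ⟨⟨ht, -⟩, hn⟩
          have : y ∉ tsupport k := fun h => hn ⟨ht, h⟩
          simp [image_eq_zero_of_notMem_tsupport this]
        have h3 := h2.mono_set
          (Set.prod_mono_left (t := Set.univ) (Set.uIoc_subset_uIcc (a := 0) (b := ε)))
        rwa [IntegrableOn, ← Measure.prod_restrict, Measure.restrict_univ] at h3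
    _ = ∫ t in (0 : ℝ)..ε, t • dilatedConv k' (laplacian' v) t x := by
        refine intervalIntegral.integral_congr fun t _ => ?_
        have hk'' : ∀ j : Fin d, Continuous fun y => fderiv ℝ k' y (Pi.single j 1) := fun j =>
          (hk'.continuous_fderiv one_ne_zero).clm_apply continuous_const
        have hks'' : ∀ j : Fin d, HasCompactSupport fun y => fderiv ℝ k' y (Pi.single j 1) :=
          fun j => hks'.fderiv_apply (𝕜 := ℝ) _
        calc ∫ y, k y • -(fderiv ℝ v (x - t • y) y)
            = ∫ y, ∑ j, fderiv ℝ k' y (Pi.single j 1) • partialDeriv' j v (x - t • y) := by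
              refine integral_congr_ae (.of_forall fun y => ?_)
              simp only [fderiv_apply_eq_sum_partialDeriv', hkk', Finset.smul_sum, smul_neg,
                neg_smul, ← Finset.sum_neg_distrib, smul_smul, mul_comm]
          _ = ∑ j, dilatedConv (fun y => fderiv ℝ k' y (Pi.single j 1)) (partialDeriv' j v) t x :=
              integral_finsetSum _ fun j _ =>
                dilatedConv_integrable (hk'' j) (hks'' j) (hpd j).continuous t x
          _ = ∑ j, t • dilatedConv k' (partialDeriv' j (partialDeriv' j v)) t x :=
              Finset.sum_congr rfl fun j _ => dilatedConv_fderiv hk' hks' (hpd j) j t x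
          _ = t • dilatedConv k' (laplacian' v) t x := by
              rw [← Finset.smul_sum]
              congr 1
              simp only [dilatedConv, laplacian', Finset.smul_sum]
              exact (integral_finsetSum _ fun j _ =>
                dilatedConv_integrable hk'.continuous hks' (hpd2 j) t x).symm

end dilatedConv

section bounds

variable {d : ℕ} {k₀ k₁ k₂ : (Fin d → ℝ) → ℝ} {u : (Fin d → ℝ) → ℂ}

theorem IsC1Kernel.continuous {k : (Fin d → ℝ) → ℝ} (hk : IsC1Kernel k) : Continuous k :=
  hk.contDiff.continuous

theorem IsC1Kernel.lintegral_enorm {k : (Fin d → ℝ) → ℝ} (hk : IsC1Kernel k) :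
    ∫⁻ y, ‖k y‖ₑ = ENNReal.ofReal (∫ y, k y) := by
  rw [ofReal_integral_eq_lintegral_ofReal
    (hk.continuous.integrable_of_hasCompactSupport hk.hasCompactSupport) (.of_forall hk.nonneg)]
  exact lintegral_congr fun y => Real.enorm_of_nonneg (hk.nonneg y)

theorem lintegral_enorm_intervalIntegral_le {Φ : ℝ → (Fin d → ℝ) → ℂ}
    (hΦ : Continuous fun p : ℝ × (Fin d → ℝ) => Φ p.1 p.2) {ε : ℝ} (hε : 0 ≤ ε) {C : ℝ≥0∞}
    (hC : ∀ t, 0 < t → t ≤ ε → ∫⁻ x, ‖Φ t x‖ₑ ≤ C) :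
    ∫⁻ x, ‖∫ t in (0 : ℝ)..ε, Φ t x‖ₑ ≤ ENNReal.ofReal ε * C := by
  calc ∫⁻ x, ‖∫ t in (0 : ℝ)..ε, Φ t x‖ₑ
      ≤ ∫⁻ x, ∫⁻ t in Set.Ioc 0 ε, ‖Φ t x‖ₑ := by
        refine lintegral_mono fun x => ?_
        rw [intervalIntegral.integral_of_le hε]
        exact enorm_integral_le_lintegral_enorm _
    _ = ∫⁻ t in Set.Ioc 0 ε, ∫⁻ x, ‖Φ t x‖ₑ :=
        lintegral_lintegral_swap (hΦ.comp continuous_swap).measurable.enorm.aemeasurable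
    _ ≤ ∫⁻ _ in Set.Ioc 0 ε, C :=
        setLIntegral_mono measurable_const fun t ht => hC t ht.1 ht.2
    _ = ENNReal.ofReal ε * C := by simp [mul_comm]

theorem lintegral_enorm_sub_le {v w : (Fin d → ℝ) → ℂ} (hv : Continuous v) :
    ∫⁻ x, ‖v x - w x‖ₑ ≤ (∫⁻ x, ‖v x‖ₑ) + ∫⁻ x, ‖w x‖ₑ := by
  rw [← lintegral_add_left hv.measurable.enorm]
  exact lintegral_mono fun x => enorm_sub_le

/-- Interpolation bound for a single partial derivative. -/
theorem lintegral_partialDeriv'_le (h₀ : IsC1Kernel k₀) (h₁ : IsC1Kernel k₁)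
    (h₀₁ : ∀ y j, fderiv ℝ k₁ y (Pi.single j 1) = -(y j * k₀ y))
    (hu : ContDiff ℝ 3 u) (i : Fin d) {ε : ℝ} (hε : 0 < ε) :
    ENNReal.ofReal (∫ y, k₀ y) * ∫⁻ x, ‖partialDeriv' i u x‖ₑ ≤
      ENNReal.ofReal ε⁻¹ *
          ((∫⁻ y, ‖fderiv ℝ k₀ y (Pi.single i 1)‖ₑ) * ∫⁻ x, ‖u x‖ₑ) +
        ENNReal.ofReal ε *
          ((∫⁻ y, ‖fderiv ℝ k₁ y (Pi.single i 1)‖ₑ) * ∫⁻ x, ‖laplacian' u x‖ₑ) := by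
  have hv : ContDiff ℝ 2 (partialDeriv' i u) := partialDeriv'_contDiff hu (by norm_num) i
  have hΔ : ContDiff ℝ 1 (laplacian' u) := by
    refine ContDiff.sum fun j _ => ?_
    exact partialDeriv'_contDiff
      (partialDeriv'_contDiff (m := 2) hu (by norm_num) j) (by norm_num) j
  have hk₀' : Continuous fun y => fderiv ℝ k₀ y (Pi.single i 1) :=
    (h₀.contDiff.continuous_fderiv one_ne_zero).clm_apply continuous_const
  have hk₁' : Continuous fun y => fderiv ℝ k₁ y (Pi.single i 1) :=
    (h₁.contDiff.continuous_fderiv one_ne_zero).clm_apply continuous_const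
  have hs₀ : HasCompactSupport fun y => fderiv ℝ k₀ y (Pi.single i 1) :=
    h₀.hasCompactSupport.fderiv_apply (𝕜 := ℝ) _
  have hs₁ : HasCompactSupport fun y => fderiv ℝ k₁ y (Pi.single i 1) :=
    h₁.hasCompactSupport.fderiv_apply (𝕜 := ℝ) _
  have key : ∀ x, (∫ y, k₀ y) • partialDeriv' i u x =
      ε⁻¹ • dilatedConv (fun y => fderiv ℝ k₀ y (Pi.single i 1)) u ε x -
        ∫ t in (0 : ℝ)..ε,
          dilatedConv (fun y => fderiv ℝ k₁ y (Pi.single i 1)) (laplacian' u) t x := by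
    intro x
    have h := dilatedConv_sub_integral_smul h₀.continuous h₀.hasCompactSupport h₁.contDiff
      h₁.hasCompactSupport h₀₁ hv ε x
    rw [laplacian'_partialDeriv' hu] at h
    simp only [← dilatedConv_fderiv h₁.contDiff h₁.hasCompactSupport hΔ i] at h
    rw [← h, dilatedConv_fderiv h₀.contDiff h₀.hasCompactSupport (hu.of_le (by norm_num)) i,
      inv_smul_smul₀ hε.ne']
    simp
  have hc : ∀ t, Continuous (dilatedConv (fun y => fderiv ℝ k₀ y (Pi.single i 1)) u t) := fun t =>
    (dilatedConv_continuous hk₀' hs₀ hu.continuous).comp (Continuous.prodMk_right t)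
  calc ENNReal.ofReal (∫ y, k₀ y) * ∫⁻ x, ‖partialDeriv' i u x‖ₑ
      = ∫⁻ x, ‖(∫ y, k₀ y) • partialDeriv' i u x‖ₑ := by
        simp only [enorm_smul, Real.enorm_of_nonneg h₀.integral_pos.le]
        rw [lintegral_const_mul' _ _ ENNReal.ofReal_ne_top]
    _ ≤ (∫⁻ x, ‖ε⁻¹ • dilatedConv (fun y => fderiv ℝ k₀ y (Pi.single i 1)) u ε x‖ₑ) +
        ∫⁻ x, ‖∫ t in (0 : ℝ)..ε,
          dilatedConv (fun y => fderiv ℝ k₁ y (Pi.single i 1)) (laplacian' u) t x‖ₑ := by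
        simp only [key]
        exact lintegral_enorm_sub_le (by fun_prop)
    _ ≤ _ := by
        gcongr
        · simp only [enorm_smul, Real.enorm_of_nonneg (inv_pos.2 hε).le]
          rw [lintegral_const_mul' _ _ ENNReal.ofReal_ne_top]
          gcongr
          exact lintegral_dilatedConv_le hk₀' hu.continuous ε
        · exact lintegral_enorm_intervalIntegral_le
            (dilatedConv_continuous hk₁' hs₁ hΔ.continuous) hε.le
            fun t _ _ => lintegral_dilatedConv_le hk₁' hΔ.continuous t

theorem lintegral_dilatedConv_sub_le (h₁ : IsC1Kernel k₁) (h₂ : IsC1Kernel k₂)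
    (h₁₂ : ∀ y j, fderiv ℝ k₂ y (Pi.single j 1) = -(y j * k₁ y))
    (hu : ContDiff ℝ 2 u) {t : ℝ} (ht : 0 ≤ t) :
    ∫⁻ x, ‖dilatedConv k₁ u t x - (∫ y, k₁ y) • u x‖ₑ ≤
      ENNReal.ofReal t * (ENNReal.ofReal t *
        (ENNReal.ofReal (∫ y, k₂ y) * ∫⁻ x, ‖laplacian' u x‖ₑ)) := by
  have hΔ := laplacian'_continuous hu
  simp only [dilatedConv_sub_integral_smul h₁.continuous h₁.hasCompactSupport h₂.contDiff
      h₂.hasCompactSupport h₁₂ hu t]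
  refine lintegral_enorm_intervalIntegral_le (continuous_fst.smul
    (dilatedConv_continuous h₂.continuous h₂.hasCompactSupport hΔ)) ht fun s hs hst => ?_
  simp only [enorm_smul]
  rw [lintegral_const_mul' _ _ enorm_ne_top, Real.enorm_of_nonneg hs.le, ← h₂.lintegral_enorm]
  gcongr
  exact lintegral_dilatedConv_le h₂.continuous hΔ s

theorem add_mul_lintegral_enorm_le_resolvent (h₀ : IsC1Kernel k₀) (h₁ : IsC1Kernel k₁) (h₂ : IsC1Kernel k₂)
    (h₀₁ : ∀ y j, fderiv ℝ k₁ y (Pi.single j 1) = -(y j * k₀ y))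
    (h₁₂ : ∀ y j, fderiv ℝ k₂ y (Pi.single j 1) = -(y j * k₁ y))
    (hu : ContDiff ℝ 2 u) {ε : ℝ} (hε : 0 < ε) :
    ENNReal.ofReal ((∫ y, k₀ y) + ε ^ 2 / 2 * ∫ y, k₁ y) * ∫⁻ x, ‖u x‖ₑ ≤
      ENNReal.ofReal (∫ y, k₀ y) * (∫⁻ x, ‖u x‖ₑ) +
        ENNReal.ofReal ε * (ENNReal.ofReal ε *
          (ENNReal.ofReal ε * (ENNReal.ofReal ε *
            (ENNReal.ofReal (∫ y, k₂ y) * ∫⁻ x, ‖laplacian' u x‖ₑ)) +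
          ENNReal.ofReal (∫ y, k₁ y) * ∫⁻ x, ‖u x - laplacian' u x‖ₑ)) := by
  have hu0 := hu.continuous
  have hΔ := laplacian'_continuous hu
  have hc₁ : Continuous fun p : ℝ × (Fin d → ℝ) =>
      dilatedConv k₁ (laplacian' u) p.1 p.2 - (∫ y, k₁ y) • u p.2 :=
    (dilatedConv_continuous h₁.continuous h₁.hasCompactSupport hΔ).sub
      (by fun_prop)
  have hc₁' : ∀ t, Continuous (dilatedConv k₁ u t) := fun t =>
    (dilatedConv_continuous h₁.continuous h₁.hasCompactSupport hu0).comp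
      (Continuous.prodMk_right t)
  have hc₀ : Continuous (dilatedConv k₀ u ε) :=
    (dilatedConv_continuous h₀.continuous h₀.hasCompactSupport hu0).comp
      (Continuous.prodMk_right ε)
  have key : ∀ x, ((∫ y, k₀ y) + ε ^ 2 / 2 * ∫ y, k₁ y) • u x =
      dilatedConv k₀ u ε x - ∫ t in (0 : ℝ)..ε,
        t • (dilatedConv k₁ (laplacian' u) t x - (∫ y, k₁ y) • u x) := by
    intro x
    have h := dilatedConv_sub_integral_smul h₀.continuous h₀.hasCompactSupport h₁.contDiff
      h₁.hasCompactSupport h₀₁ hu ε x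
    have hcx : Continuous fun t => dilatedConv k₁ (laplacian' u) t x :=
      (dilatedConv_continuous h₁.continuous h₁.hasCompactSupport hΔ).comp
        (Continuous.prodMk_left x)
    simp only [smul_sub]
    rw [intervalIntegral.integral_sub (Continuous.intervalIntegrable (by fun_prop) _ _)
      (Continuous.intervalIntegrable (by fun_prop) _ _), ← h,
      intervalIntegral.integral_smul_const, integral_id, add_smul, mul_smul]
    simp only [zero_pow two_ne_zero, sub_zero]
    abel
  have hD : ∀ t x, dilatedConv k₁ (laplacian' u) t x - (∫ y, k₁ y) • u x =
      (dilatedConv k₁ u t x - (∫ y, k₁ y) • u x) -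
        dilatedConv k₁ (fun x => u x - laplacian' u x) t x := by
    intro t x
    rw [dilatedConv_sub h₁.continuous h₁.hasCompactSupport hu0 hΔ]
    abel
  have hpos : 0 ≤ (∫ y, k₀ y) + ε ^ 2 / 2 * ∫ y, k₁ y := by
    have := h₀.integral_pos
    have := h₁.integral_pos
    positivity
  calc ENNReal.ofReal ((∫ y, k₀ y) + ε ^ 2 / 2 * ∫ y, k₁ y) * ∫⁻ x, ‖u x‖ₑ
      = ∫⁻ x, ‖((∫ y, k₀ y) + ε ^ 2 / 2 * ∫ y, k₁ y) • u x‖ₑ := by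
        simp only [enorm_smul, Real.enorm_of_nonneg hpos]
        rw [lintegral_const_mul' _ _ ENNReal.ofReal_ne_top]
    _ ≤ (∫⁻ x, ‖dilatedConv k₀ u ε x‖ₑ) + ∫⁻ x, ‖∫ t in (0 : ℝ)..ε,
        t • (dilatedConv k₁ (laplacian' u) t x - (∫ y, k₁ y) • u x)‖ₑ := by
        simp only [key]
        exact lintegral_enorm_sub_le hc₀
    _ ≤ _ := by
        gcongr
        · rw [← h₀.lintegral_enorm]
          exact lintegral_dilatedConv_le h₀.continuous hu0 ε
        · refine lintegral_enorm_intervalIntegral_le (continuous_fst.smul hc₁) hε.le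
            fun t ht htε => ?_
          simp only [enorm_smul]
          rw [lintegral_const_mul' _ _ enorm_ne_top, Real.enorm_of_nonneg ht.le]
          gcongr
          simp only [hD]
          refine (lintegral_enorm_sub_le (by fun_prop)).trans ?_
          gcongr
          · refine (lintegral_dilatedConv_sub_le h₁ h₂ h₁₂ hu ht.le).trans ?_
            gcongr
          · rw [← h₁.lintegral_enorm]
            exact lintegral_dilatedConv_le (v := fun x => u x - laplacian' u x) h₁.continuous
              (by fun_prop) t

/-- The resolvent `(1 - Δ)⁻¹` is bounded on `L¹`. -/
theorem lintegral_enorm_le_five_mul_resolvent (hu : ContDiff ℝ 2 u)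
    (hU : ∫⁻ x, ‖u x‖ₑ ≠ ∞) (hL : ∫⁻ x, ‖laplacian' u x‖ₑ ≠ ∞) :
    ∫⁻ x, ‖u x‖ₑ ≤ 5 * ∫⁻ x, ‖u x - laplacian' u x‖ₑ := by
  obtain ⟨k₀, k₁, k₂, h₀, h₁, h₂, h₀₁, h₁₂⟩ := exists_isC1Kernel_chain d
  have hu0 := hu.continuous
  have hΔ := laplacian'_continuous hu
  have hF : ∫⁻ x, ‖u x - laplacian' u x‖ₑ ≠ ∞ :=
    ne_top_of_le_ne_top (ENNReal.add_ne_top.2 ⟨hU, hL⟩) (lintegral_enorm_sub_le hu0)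
  have hLUF : ∫⁻ x, ‖laplacian' u x‖ₑ ≤
      (∫⁻ x, ‖u x‖ₑ) + ∫⁻ x, ‖u x - laplacian' u x‖ₑ := by
    simpa using lintegral_enorm_sub_le (w := fun x => u x - laplacian' u x) hu0
  have hA := h₀.integral_pos
  have hB := h₁.integral_pos
  have hH := h₂.integral_pos
  set A := ∫ y, k₀ y
  set B := ∫ y, k₁ y
  set H := ∫ y, k₂ y
  have hε2 : Real.sqrt (B / (4 * H)) ^ 2 = B / (4 * H) := Real.sq_sqrt (by positivity)
  have hε : 0 < Real.sqrt (B / (4 * H)) := by positivity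
  have main := add_mul_lintegral_enorm_le_resolvent h₀ h₁ h₂ h₀₁ h₁₂ hu hε
  set ε := Real.sqrt (B / (4 * H))
  lift ∫⁻ x, ‖u x‖ₑ to NNReal using hU with U
  lift ∫⁻ x, ‖laplacian' u x‖ₑ to NNReal using hL with L
  lift ∫⁻ x, ‖u x - laplacian' u x‖ₑ to NNReal using hF with F
  have hLUF' : (L : ℝ) ≤ U + F := by exact_mod_cast hLUF
  simp only [← ENNReal.ofReal_coe_nnreal] at main ⊢
  have hAB : 0 ≤ A + ε ^ 2 / 2 * B := by positivity
  have hU0 : (0 : ℝ) ≤ U := U.2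
  have hL0 : (0 : ℝ) ≤ L := L.2
  have hF0 : (0 : ℝ) ≤ F := F.2
  rw [← ENNReal.ofReal_mul hAB, ← ENNReal.ofReal_mul hA.le, ← ENNReal.ofReal_mul hH.le,
    ← ENNReal.ofReal_mul hB.le, ← ENNReal.ofReal_mul hε.le, ← ENNReal.ofReal_mul hε.le,
    ← ENNReal.ofReal_add (by positivity) (by positivity), ← ENNReal.ofReal_mul hε.le,
    ← ENNReal.ofReal_mul hε.le, ← ENNReal.ofReal_add (by positivity) (by positivity),
    ENNReal.ofReal_le_ofReal_iff (by positivity)] at main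
  rw [← ENNReal.ofReal_ofNat 5, ← ENNReal.ofReal_mul (by norm_num)]
  refine ENNReal.ofReal_le_ofReal ?_
  have hεH : ε ^ 2 * H = B / 4 := by rw [hε2]; field_simp
  have e1 : ε ^ 2 * (B / 2 * U) ≤ ε ^ 2 * (B / 4 * (U + F) + B * F) := by
    calc ε ^ 2 * (B / 2 * U) ≤ ε ^ 2 * ((ε ^ 2 * H) * L + B * F) := by linarith
      _ ≤ _ := by rw [hεH]; gcongr
  have e2 := le_of_mul_le_mul_left e1 (by positivity)
  have e3 : B * U ≤ B * (5 * F) := by linarith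
  exact le_of_mul_le_mul_left e3 hB

theorem gradLen_le_sum (x : Fin d → ℝ) : gradLen u x ≤ ∑ i, ‖partialDeriv' i u x‖ := by
  refine Real.sqrt_le_iff.2 ⟨by positivity, ?_⟩
  exact Finset.sum_sq_le_sq_sum_of_nonneg fun i _ => norm_nonneg _

theorem lintegral_gradLen_le_sum (hu : ContDiff ℝ 1 u) :
    ∫⁻ x, ‖gradLen u x‖ₑ ≤ ∑ i, ∫⁻ x, ‖partialDeriv' i u x‖ₑ := by
  rw [← lintegral_finsetSum _ fun i _ =>
    (partialDeriv'_contDiff (m := 0) hu (by norm_num) i).continuous.measurable.enorm]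
  refine lintegral_mono fun x => ?_
  calc ‖gradLen u x‖ₑ = ENNReal.ofReal (gradLen u x) :=
        Real.enorm_of_nonneg (Real.sqrt_nonneg _)
    _ ≤ ENNReal.ofReal (∑ i, ‖partialDeriv' i u x‖) := ENNReal.ofReal_le_ofReal (gradLen_le_sum x)
    _ = ∑ i, ‖partialDeriv' i u x‖ₑ := by
        rw [ENNReal.ofReal_sum_of_nonneg fun i _ => norm_nonneg _]
        simp only [ofReal_norm]

/-- The interpolation inequality with parameter. -/
theorem exists_lintegral_gradLen_le (d : ℕ) :
    ∃ c : ℝ, 0 < c ∧ ∀ u : (Fin d → ℝ) → ℂ, ContDiff ℝ 3 u → ∀ ε : ℝ, 0 < ε →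
      ∫⁻ x, ‖gradLen u x‖ₑ ≤ ENNReal.ofReal c *
        (ENNReal.ofReal ε * (∫⁻ x, ‖laplacian' u x‖ₑ) + ENNReal.ofReal ε⁻¹ * ∫⁻ x, ‖u x‖ₑ) := by
  obtain ⟨k₀, k₁, -, h₀, h₁, -, h₀₁, -⟩ := exists_isC1Kernel_chain d
  have hfin : ∀ k : (Fin d → ℝ) → ℝ, IsC1Kernel k → ∀ i,
      ∫⁻ y, ‖fderiv ℝ k y (Pi.single i 1)‖ₑ ≠ ∞ := fun k hk i =>
    (Continuous.integrable_of_hasCompactSupport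
      ((hk.contDiff.continuous_fderiv one_ne_zero).clm_apply continuous_const)
      (hk.hasCompactSupport.fderiv_apply (𝕜 := ℝ) _)).hasFiniteIntegral.ne
  set A := ENNReal.ofReal (∫ y, k₀ y) with hA
  have hA0 : A ≠ 0 := by simpa [hA] using h₀.integral_pos
  have hAt : A ≠ ∞ := ENNReal.ofReal_ne_top
  set K : ℝ≥0∞ := ∑ i, A⁻¹ * ((∫⁻ y, ‖fderiv ℝ k₀ y (Pi.single i 1)‖ₑ) +
    ∫⁻ y, ‖fderiv ℝ k₁ y (Pi.single i 1)‖ₑ) with hK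
  have hKt : K ≠ ∞ := ENNReal.sum_ne_top.2 fun i _ => ENNReal.mul_ne_top
    (ENNReal.inv_ne_top.2 hA0) (ENNReal.add_ne_top.2 ⟨hfin k₀ h₀ i, hfin k₁ h₁ i⟩)
  refine ⟨K.toReal + 1, by positivity, fun u hu ε hε => ?_⟩
  have hKc : K ≤ ENNReal.ofReal (K.toReal + 1) := by
    rw [ENNReal.le_ofReal_iff_toReal_le hKt (by positivity)]
    linarith
  refine (lintegral_gradLen_le_sum (hu.of_le (by norm_num))).trans ?_
  refine le_trans ?_ (mul_le_mul_left hKc _)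
  rw [hK, Finset.sum_mul]
  refine Finset.sum_le_sum fun i _ => ?_
  have h := lintegral_partialDeriv'_le h₀ h₁ h₀₁ hu i hε
  rw [mul_assoc, ← ENNReal.mul_le_iff_le_inv hA0 hAt]
  refine h.trans ?_
  rw [mul_add, add_comm]
  gcongr ?_ + ?_
  · rw [mul_left_comm]
    gcongr
    exact le_add_self
  · rw [mul_left_comm]
    gcongr
    exact le_self_add

end bounds

/-- **The `L¹` interpolation inequality** (estimates (3.11)–(3.12) of the paper):
for `d ≥ 1` there is `c = c(d) > 0` such that for every smooth `u` with
`u, Δu ∈ L¹(ℝᵈ)` one has `‖∇u‖_{L¹} ≤ c ‖u − Δu‖_{L¹}`, and consequently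
`‖∇u‖_{L¹} ≤ c (ε ‖Δu‖_{L¹} + ε⁻¹ ‖u‖_{L¹})` for every `ε > 0`. -/
theorem gradient_L1_interpolation (d : ℕ) (hd : 1 ≤ d) :
    ∃ c : ℝ, 0 < c ∧
      ∀ u : (Fin d → ℝ) → ℂ, ContDiff ℝ (⊤ : ℕ∞) u →
        eLpNorm u 1 volume ≠ ∞ → eLpNorm (laplacian' u) 1 volume ≠ ∞ →
        (eLpNorm (gradLen u) 1 volume ≤
          ENNReal.ofReal c * eLpNorm (fun x => u x - laplacian' u x) 1 volume) ∧
        ∀ ε : ℝ, 0 < ε →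
          eLpNorm (gradLen u) 1 volume ≤
            ENNReal.ofReal c *
              (ENNReal.ofReal ε * eLpNorm (laplacian' u) 1 volume +
                ENNReal.ofReal ε⁻¹ * eLpNorm u 1 volume) := by
  obtain ⟨c, hc, hgrad⟩ := exists_lintegral_gradLen_le d
  refine ⟨11 * c, by positivity, fun u hu hU hL => ?_⟩
  have hu3 : ContDiff ℝ 3 u := mod_cast contDiff_infty.1 hu 3
  have hu2 : ContDiff ℝ 2 u := hu3.of_le (by norm_num)
  simp only [eLpNorm_one_eq_lintegral_enorm] at hU hL ⊢
  have h5 := lintegral_enorm_le_five_mul_resolvent hu2 hU hL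
  have hLUF : ∫⁻ x, ‖laplacian' u x‖ₑ ≤
      (∫⁻ x, ‖u x‖ₑ) + ∫⁻ x, ‖u x - laplacian' u x‖ₑ := by
    simpa using lintegral_enorm_sub_le (w := fun x => u x - laplacian' u x) hu2.continuous
  constructor
  · refine (hgrad u hu3 1 one_pos).trans ?_
    rw [inv_one, ENNReal.ofReal_one, one_mul, one_mul, mul_comm 11 c, ENNReal.ofReal_mul hc.le,
      mul_assoc, ENNReal.ofReal_ofNat]
    gcongr
    calc (∫⁻ x, ‖laplacian' u x‖ₑ) + ∫⁻ x, ‖u x‖ₑ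
        ≤ (5 * (∫⁻ x, ‖u x - laplacian' u x‖ₑ) + ∫⁻ x, ‖u x - laplacian' u x‖ₑ) +
            5 * ∫⁻ x, ‖u x - laplacian' u x‖ₑ :=
          add_le_add (hLUF.trans (by gcongr)) h5
      _ = 11 * ∫⁻ x, ‖u x - laplacian' u x‖ₑ := by ring
  · intro ε hε
    refine (hgrad u hu3 ε hε).trans ?_
    gcongr
    linarith
end
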